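/- For every finite simple graph G and every integer s ≥ 1, reg(I(G)^s) ≤ 2s + min-match_{K2,C5}(G) − 1. -/

import Mathlib

open SimpleGraph

namespace Paper

/-- The complete graph on two vertices, `K₂`. -/
def k2 : SimpleGraph (Fin 2) := ⊤

/-- The 5-cycle `C₅`. -/
def cycle5 : SimpleGraph (ZMod 5) := SimpleGraph.fromRel (fun a b => b = a + 1)

/-- A graph is chordal if it has no induced cycle of length at least four. -/
def IsChordal {V : Type*} (G : SimpleGraph V) : Prop :=
  ∀ n : ℕ, 4 ≤ n → IsEmpty (SimpleGraph.cycleGraph n ↪g G)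

/-- A graph is co-chordal if its complement is chordal. -/
def IsCochordal {V : Type*} (G : SimpleGraph V) : Prop := IsChordal Gᶜ

/-- The co-chordal cover number: the minimum number of co-chordal subgraphs of `G`
needed to cover all edges of `G`. -/
noncomputable def cochord {V : Type*} (G : SimpleGraph V) : ℕ :=
  sInf { t | ∃ f : Fin t → SimpleGraph V,
    (∀ i, f i ≤ G ∧ IsCochordal (f i)) ∧ ∀ ⦃u v : V⦄, G.Adj u v → ∃ i, (f i).Adj u v }

/-- The closed neighborhood `N_G[w]`. -/
def closedNbhd {V : Type*} (G : SimpleGraph V) (w : V) : Set V :=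
  insert w (G.neighborSet w)

/-- The graph `G - N_G[w]`: the induced subgraph on the complement of the closed
neighborhood of `w`. -/
def delClosedNbhd {V : Type*} (G : SimpleGraph V) (w : V) :
    SimpleGraph ((closedNbhd G w)ᶜ : Set V) := G.induce _

/-- A maximal matching: a matching such that no edge of `G` is disjoint from all of
its edges. -/
def IsMaximalMatching {V : Type*} (G : SimpleGraph V) (M : G.Subgraph) : Prop :=
  M.IsMatching ∧ ∀ ⦃u v : V⦄, G.Adj u v → u ∈ M.support ∨ v ∈ M.support

/-- The minimum matching number: the minimum cardinality of a maximal matching. -/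
noncomputable def minMatch {V : Type*} (G : SimpleGraph V) : ℕ :=
  sInf { k | ∃ M : G.Subgraph, IsMaximalMatching G M ∧ M.edgeSet.ncard = k }

/-- The matching number of a graph: maximum cardinality of a matching. -/
noncomputable def matchNum {V : Type*} (G : SimpleGraph V) : ℕ :=
  sSup { k | ∃ M : G.Subgraph, M.IsMatching ∧ M.edgeSet.ncard = k }

/-- A graph all of whose connected components are isomorphic to `K₂` or `C₅`. -/
def IsK2C5Graph {V : Type*} (G : SimpleGraph V) : Prop :=
  ∀ c : G.ConnectedComponent,
    Nonempty (G.induce c.supp ≃g k2) ∨ Nonempty (G.induce c.supp ≃g cycle5)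

/-- A maximal `{K₂, C₅}`-subgraph of `G`: a subgraph whose components are all `K₂` or
`C₅` such that the induced subgraph of `G` on the vertices outside it has no edge. -/
def IsMaximalK2C5Subgraph {V : Type*} (G : SimpleGraph V) (H : G.Subgraph) : Prop :=
  IsK2C5Graph H.coe ∧ ∀ ⦃u v : V⦄, G.Adj u v → u ∈ H.verts ∨ v ∈ H.verts

/-- `min-match_{K₂,C₅}(G)`: the minimum matching number of a maximal
`{K₂, C₅}`-subgraph of `G` (with value `0` if `G` has no edge, via `sInf ∅ = 0`:
if `G` is edgeless the empty subgraph is a maximal `{K₂,C₅}`-subgraph). -/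
noncomputable def minMatchK2C5 {V : Type*} (G : SimpleGraph V) : ℕ :=
  sInf { k | ∃ H : G.Subgraph, IsMaximalK2C5Subgraph G H ∧ matchNum H.coe = k }

/-- An induced matching of `G`. -/
def IsInducedMatching {V : Type*} (G : SimpleGraph V) (M : G.Subgraph) : Prop :=
  M.IsMatching ∧ ∀ ⦃u v : V⦄, G.Adj u v → u ∈ M.support → v ∈ M.support → M.Adj u v

/-- The induced matching number of `G`. -/
noncomputable def indMatch {V : Type*} (G : SimpleGraph V) : ℕ :=
  sSup { k | ∃ M : G.Subgraph, IsInducedMatching G M ∧ M.edgeSet.ncard = k }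

/-- `ind-match_{K₂,C₅}(G)`: the maximum matching number of an induced subgraph of `G`
all of whose connected components are `K₂` or `C₅`. -/
noncomputable def indMatchK2C5 {V : Type*} (G : SimpleGraph V) : ℕ :=
  sSup { k | ∃ s : Set V, IsK2C5Graph (G.induce s) ∧ matchNum (G.induce s) = k }

/-- The edge ideal of a graph `G`, in the polynomial ring over `K` with variables
indexed by the vertices of `G`. -/
noncomputable def edgeIdeal (K : Type) [Field K] {V : Type} (G : SimpleGraph V) :
    Ideal (MvPolynomial V K) :=
  Ideal.span { m | ∃ u v : V, G.Adj u v ∧ m = MvPolynomial.X u * MvPolynomial.X v }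

/-- `HasResolutionDegreeBound K I r` says that the ideal `I` admits a graded free
resolution `⋯ → F₁ → F₀ → I → 0`, where `Fᵢ = ⊕_k S(-d i k)` is a graded free module
whose generators sit in degrees `d i k ≤ i + r`.  The maps are required to be graded
(degree-preserving) and the sequence exact.  By the standard characterization via the
minimal graded free resolution, the Castelnuovo–Mumford regularity of `I` is the least
`r` for which such a resolution exists. -/
def HasResolutionDegreeBound (K : Type) [Field K] {V : Type}
    (I : Ideal (MvPolynomial V K)) (r : ℕ) : Prop :=
  ∃ (m : ℕ → ℕ) (d : (i : ℕ) → Fin (m i) → ℕ)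
    (f : (i : ℕ) → ((Fin (m (i + 1)) → MvPolynomial V K) →ₗ[MvPolynomial V K]
        (Fin (m i) → MvPolynomial V K)))
    (ε : (Fin (m 0) → MvPolynomial V K) →ₗ[MvPolynomial V K] MvPolynomial V K),
    -- the augmentation map is graded: the image of the `k`-th basis vector is
    -- homogeneous of degree `d 0 k`
    (∀ k, MvPolynomial.IsHomogeneous (ε (Pi.single k 1)) (d 0 k)) ∧
    -- the differentials are graded maps of degree zero
    (∀ i k l, MvPolynomial.IsHomogeneous (f i (Pi.single k 1) l) (d (i + 1) k - d i l) ∧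
        (d (i + 1) k < d i l → f i (Pi.single k 1) l = 0)) ∧
    -- exactness: `F₀` surjects onto `I`, and the complex is exact
    LinearMap.range ε = I ∧
    LinearMap.range (f 0) = LinearMap.ker ε ∧
    (∀ i, LinearMap.range (f (i + 1)) = LinearMap.ker (f i)) ∧
    -- the degree bound on the twists
    (∀ i k, d i k ≤ i + r)

/-- The Castelnuovo–Mumford regularity of an ideal in a polynomial ring:
the least `r` such that `I` has a graded free resolution whose `i`-th free module is
generated in degrees `≤ i + r`. -/
noncomputable def reg (K : Type) [Field K] {V : Type} (I : Ideal (MvPolynomial V K)) : ℕ :=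
  sInf { r | HasResolutionDegreeBound K I r }

/-- Homogeneity of a polynomial with respect to an integer degree, so that only `0` is
homogeneous of negative degree. -/
def IsHomog {K : Type} [Field K] {V : Type} (i : ℤ) (p : MvPolynomial V K) : Prop :=
  ∀ m ∈ p.support, (m.degree : ℤ) = i

/-- A module over the polynomial ring with a family of graded pieces. -/
structure GrMod (K : Type) [Field K] (V : Type) where
  /-- The underlying module. -/
  carrier : Type
  [addCommGroup : AddCommGroup carrier]
  [module : Module (MvPolynomial V K) carrier]
  /-- The homogeneous elements of each degree. -/
  piece : ℤ → AddSubgroup carrier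
  smul_mem : ∀ {i j : ℤ} {p : MvPolynomial V K} {x : carrier},
    IsHomog i p → x ∈ piece j → p • x ∈ piece (i + j)

attribute [instance] GrMod.addCommGroup GrMod.module

section Homog

variable {K : Type} [Field K] {V : Type}

theorem IsHomog.zero (i : ℤ) : IsHomog i (0 : MvPolynomial V K) := by
  intro m hm; simp at hm

theorem IsHomog.add {i : ℤ} {p q : MvPolynomial V K} (hp : IsHomog i p) (hq : IsHomog i q) :
    IsHomog i (p + q) := by
  classical
  intro m hm
  rcases Finset.mem_union.1 (MvPolynomial.support_add hm) with h | h
  exacts [hp m h, hq m h]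

theorem IsHomog.neg {i : ℤ} {p : MvPolynomial V K} (hp : IsHomog i p) : IsHomog i (-p) := by
  intro m hm
  exact hp m (by simpa using hm)

theorem IsHomog.mul {i j : ℤ} {p q : MvPolynomial V K} (hp : IsHomog i p) (hq : IsHomog j q) :
    IsHomog (i + j) (p * q) := by
  classical
  intro m hm
  obtain ⟨a, ha, b, hb, rfl⟩ := Finset.mem_add.1 (MvPolynomial.support_mul p q hm)
  rw [map_add, ← hp a ha, ← hq b hb, Nat.cast_add]

theorem isHomog_monomial (m : V →₀ ℕ) (c : K) :
    IsHomog (m.degree : ℤ) (MvPolynomial.monomial m c) := by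
  classical
  intro n hn
  have := MvPolynomial.support_monomial_subset hn
  rw [Finset.mem_singleton.1 this]

theorem isHomog_one : IsHomog 0 (1 : MvPolynomial V K) := by
  simpa using isHomog_monomial (K := K) (0 : V →₀ ℕ) 1

theorem IsHomog.isHomogeneous {n : ℕ} {p : MvPolynomial V K} (hp : IsHomog (n : ℤ) p) :
    p.IsHomogeneous n := by
  intro m hm
  have := hp m (MvPolynomial.mem_support_iff.2 hm)
  have h1 : (Finsupp.weight 1) m = m.degree := by
    rw [Finsupp.degree_eq_weight_one]; rfl
  rw [h1]
  exact_mod_cast this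

theorem IsHomog.eq_zero {i : ℤ} {p : MvPolynomial V K} (hp : IsHomog i p) (hi : i < 0) :
    p = 0 := by
  rw [← MvPolynomial.support_eq_empty, Finset.eq_empty_iff_forall_notMem]
  intro m hm
  have := hp m hm
  omega

/-- The additive group of homogeneous polynomials of a given degree. -/
noncomputable def homogSubgroup (K : Type) [Field K] (V : Type) (i : ℤ) :
    AddSubgroup (MvPolynomial V K) where
  carrier := {p | IsHomog i p}
  add_mem' := IsHomog.add
  zero_mem' := IsHomog.zero i
  neg_mem' := IsHomog.neg

end Homog

namespace GrMod

variable {K : Type} [Field K] {V : Type}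

/-- The graded free module with generators in degrees `d k`. -/
noncomputable abbrev free {n : ℕ} (d : Fin n → ℕ) : GrMod K V where
  carrier := Fin n → MvPolynomial V K
  piece j :=
    { carrier := {v | ∀ l, IsHomog (j - d l) (v l)}
      add_mem' := fun ha hb l => (ha l).add (hb l)
      zero_mem' := fun l => IsHomog.zero _
      neg_mem' := fun ha l => (ha l).neg }
  smul_mem := by
    intro i j p x hp hx l
    have := hp.mul (hx l)
    rwa [← add_sub_assoc] at this

/-- A submodule with the induced grading. -/
noncomputable abbrev sub (M : GrMod K V) (N : Submodule (MvPolynomial V K) M.carrier) : GrMod K V where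
  carrier := N
  piece j := (M.piece j).comap N.subtype.toAddMonoidHom
  smul_mem := fun hp hx => M.smul_mem hp hx

/-- The shifted module `M(-d)`. -/
noncomputable abbrev shift (M : GrMod K V) (d : ℕ) : GrMod K V where
  carrier := M.carrier
  piece j := M.piece (j - d)
  smul_mem := by
    intro i j p x hp hx
    have := M.smul_mem hp hx
    rwa [← add_sub_assoc] at this

/-- The direct sum of two graded modules. -/
noncomputable abbrev prod (M N : GrMod K V) : GrMod K V where
  carrier := M.carrier × N.carrier
  piece j := (M.piece j).prod (N.piece j)
  smul_mem := fun hp hx => ⟨M.smul_mem hp hx.1, N.smul_mem hp hx.2⟩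

/-- The polynomial ring as a graded module over itself. -/
noncomputable abbrev ring (K : Type) [Field K] (V : Type) : GrMod K V where
  carrier := MvPolynomial V K
  piece j := homogSubgroup K V j
  smul_mem := fun hp hx => IsHomog.mul hp hx

/-- An ideal with the standard grading. -/
noncomputable abbrev ofIdeal (I : Ideal (MvPolynomial V K)) : GrMod K V := sub (ring K V) I

/-- Short exact sequences of graded modules. -/
structure IsSES {A B C : GrMod K V} (f : A.carrier →ₗ[MvPolynomial V K] B.carrier)
    (g : B.carrier →ₗ[MvPolynomial V K] C.carrier) : Prop where
  inj : Function.Injective f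
  comp : ∀ a, g (f a) = 0
  exact : ∀ b, g b = 0 → ∃ a, f a = b
  piece_iff : ∀ j a, f a ∈ B.piece j ↔ a ∈ A.piece j
  map : ∀ j, ∀ b ∈ B.piece j, g b ∈ C.piece j
  lift : ∀ j, ∀ c ∈ C.piece j, ∃ b ∈ B.piece j, g b = c
  surj : Function.Surjective g

/-- `M` has a finite graded free cover with generators of degree at most `r` whose kernel
satisfies `P` with `r + 1`. -/
def CoverStep (P : GrMod K V → ℕ → Prop) (M : GrMod K V) (r : ℕ) : Prop :=
  ∃ (n : ℕ) (d : Fin n → ℕ)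
    (φ : (free (K := K) (V := V) d).carrier →ₗ[MvPolynomial V K] M.carrier),
    (∀ k, d k ≤ r) ∧ (∀ j, ∀ v ∈ (free d).piece j, φ v ∈ M.piece j) ∧
    (∀ j, ∀ a ∈ M.piece j, ∃ v ∈ (free d).piece j, φ v = a) ∧ Function.Surjective φ ∧
    P ((free d).sub (LinearMap.ker φ)) (r + 1)

/-- `M` has a graded free resolution whose `i`-th module is generated in degrees at most
`i + r` (defined coinductively). -/
def RegLE (M : GrMod K V) (r : ℕ) : Prop :=
  ∃ P : GrMod K V → ℕ → Prop, (∀ M r, P M r → CoverStep P M r) ∧ P M r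

theorem CoverStep.mono {P Q : GrMod K V → ℕ → Prop} (h : ∀ M r, P M r → Q M r)
    {M : GrMod K V} {r : ℕ} : CoverStep P M r → CoverStep Q M r := by
  rintro ⟨n, d, φ, h1, h2, h3, h4, h5⟩
  exact ⟨n, d, φ, h1, h2, h3, h4, h _ _ h5⟩

theorem RegLE.coverStep {M : GrMod K V} {r : ℕ} (h : RegLE M r) : CoverStep RegLE M r := by
  obtain ⟨P, hP, hM⟩ := h
  exact (hP M r hM).mono fun M r h => ⟨P, hP, h⟩

theorem RegLE.of_coverStep {M : GrMod K V} {r : ℕ} (h : CoverStep RegLE M r) : RegLE M r :=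
  ⟨CoverStep RegLE, fun _ _ h => h.mono fun _ _ h => h.coverStep, h⟩

theorem RegLE.succ {M : GrMod K V} {r : ℕ} (h : RegLE M r) : RegLE M (r + 1) := by
  refine ⟨fun M r => ∃ r', r = r' + 1 ∧ RegLE M r', ?_, r, rfl, h⟩
  rintro M _ ⟨r, rfl, h⟩
  obtain ⟨n, d, φ, h1, h2, h3, h4, h5⟩ := h.coverStep
  exact ⟨n, d, φ, fun k => (h1 k).trans (Nat.le_succ r), h2, h3, h4, r + 1, rfl, h5⟩

theorem RegLE.mono {M : GrMod K V} {r s : ℕ} (h : RegLE M r) (hrs : r ≤ s) : RegLE M s := by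
  induction hrs with
  | refl => exact h
  | step _ ih => exact ih.succ

theorem RegLE.of_subsingleton {M : GrMod K V} (hM : Subsingleton M.carrier) (r : ℕ) :
    RegLE M r := by
  refine ⟨fun M _ => Subsingleton M.carrier, ?_, hM⟩
  intro M r hM
  refine ⟨0, Fin.elim0, 0, fun k => k.elim0, ?_, ?_, fun a => ⟨0, Subsingleton.elim _ _⟩, ?_⟩
  · intro j v _
    rw [Subsingleton.elim ((0 : _ →ₗ[MvPolynomial V K] M.carrier) v) 0]
    exact zero_mem _
  · intro j a _
    exact ⟨0, zero_mem _, Subsingleton.elim _ _⟩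
  · refine ⟨fun a b => Subtype.ext (funext fun k => k.elim0)⟩

theorem RegLE.of_equiv_shift {M M' : GrMod K V} {r : ℕ} (h : RegLE M r) (d : ℕ)
    (e : M.carrier ≃ₗ[MvPolynomial V K] M'.carrier)
    (he : ∀ (j : ℤ) (x : M.carrier), e x ∈ M'.piece j ↔ x ∈ M.piece (j - d)) :
    RegLE M' (r + d) := by
  refine ⟨fun M' r' => ∃ (M : GrMod K V) (r : ℕ)
    (e : M.carrier ≃ₗ[MvPolynomial V K] M'.carrier), RegLE M r ∧ r' = r + d ∧
      ∀ (j : ℤ) (x : M.carrier), e x ∈ M'.piece j ↔ x ∈ M.piece (j - d), ?_, M, r, e, h, rfl, he⟩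
  rintro M' _ ⟨M, r, e, h, rfl, he⟩
  obtain ⟨n, c, φ, h1, h2, h3, h4, h5⟩ := h.coverStep
  have key : ∀ (j : ℤ) (v : Fin n → MvPolynomial V K),
      v ∈ (free (K := K) (V := V) fun k => c k + d).piece j ↔
        v ∈ (free (K := K) (V := V) c).piece (j - d) := by
    intro j v
    refine forall_congr' fun l => ?_
    rw [show j - ((c l + d : ℕ) : ℤ) = j - d - c l by push_cast; ring]
  have hker : LinearMap.ker φ = LinearMap.ker (e.toLinearMap ∘ₗ φ) := by
    rw [LinearEquiv.ker_comp]
  refine ⟨n, fun k => c k + d, e.toLinearMap ∘ₗ φ, fun k => Nat.add_le_add_right (h1 k) d,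
    ?_, ?_, e.surjective.comp h4, _, r + 1, LinearEquiv.ofEq _ _ hker, h5, by ring, ?_⟩
  · intro j v hv
    exact (he _ _).2 (h2 _ v ((key _ _).1 hv))
  · intro j a ha
    obtain ⟨a, rfl⟩ := e.surjective a
    obtain ⟨v, hv, hva⟩ := h3 (j - d) a ((he _ _).1 ha)
    exact ⟨v, (key _ _).2 hv, congrArg e hva⟩
  · intro j x
    exact key j x.1

theorem RegLE.shift {M : GrMod K V} {r : ℕ} (h : RegLE M r) (d : ℕ) :
    RegLE (M.shift d) (r + d) :=
  h.of_equiv_shift d (LinearEquiv.refl _ _) fun _ _ => Iff.rfl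

theorem sum_smul_mem {M : GrMod K V} {n : ℕ} {d : Fin n → ℕ} {b : Fin n → M.carrier}
    (hb : ∀ k, b k ∈ M.piece (d k)) {j : ℤ} {v : Fin n → MvPolynomial V K}
    (hv : v ∈ (free (K := K) (V := V) d).piece j) : ∑ k, v k • b k ∈ M.piece j := by
  refine sum_mem fun k _ => ?_
  have := M.smul_mem (hv k) (hb k)
  rwa [sub_add_cancel] at this

theorem single_mem_free {n : ℕ} (d : Fin n → ℕ) (k : Fin n) :
    (Pi.single k 1 : Fin n → MvPolynomial V K) ∈ (free (K := K) (V := V) d).piece (d k) := by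
  intro l
  by_cases h : l = k
  · subst h
    simpa using isHomog_one
  · simpa [Pi.single_eq_of_ne h] using IsHomog.zero _

/-- The property of having regularity at most `r` is stable under extensions. -/
theorem RegLE.ext {A B C : GrMod K V} {f : A.carrier →ₗ[MvPolynomial V K] B.carrier}
    {g : B.carrier →ₗ[MvPolynomial V K] C.carrier} (hfg : IsSES f g) {r : ℕ}
    (hA : RegLE A r) (hC : RegLE C r) : RegLE B r := by
  refine ⟨fun B r => ∃ (A C : GrMod K V) (f : A.carrier →ₗ[MvPolynomial V K] B.carrier)
    (g : B.carrier →ₗ[MvPolynomial V K] C.carrier), IsSES f g ∧ RegLE A r ∧ RegLE C r, ?_,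
    A, C, f, g, hfg, hA, hC⟩
  clear! A B C r
  rintro B r ⟨A, C, f, g, hfg, hA, hC⟩
  obtain ⟨n, a, φ, hφ1, hφ2, hφ3, hφ4, hφ5⟩ := hA.coverStep
  obtain ⟨m, c, ψ, hψ1, hψ2, hψ3, hψ4, hψ5⟩ := hC.coverStep
  choose b hb hgb using fun k => hfg.lift _ _ (hψ2 _ _ (single_mem_free c k))
  let χ : (Fin m → MvPolynomial V K) →ₗ[MvPolynomial V K] B.carrier :=
    Fintype.linearCombination (MvPolynomial V K) b
  have hχ : g ∘ₗ χ = ψ := by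
    refine LinearMap.pi_ext' fun k => LinearMap.ext_ring ?_
    simp only [χ, LinearMap.comp_apply, LinearMap.single_apply]
    rw [Fintype.linearCombination_apply_single, one_smul, hgb]
  have hχ' : ∀ v, g (χ v) = ψ v := fun v => LinearMap.congr_fun hχ v
  have hχp : ∀ j, ∀ v ∈ (free c).piece j, χ v ∈ B.piece j := by
    intro j v hv
    exact sum_smul_mem hb hv
  let pl : (Fin (n + m) → MvPolynomial V K) →ₗ[MvPolynomial V K] (Fin n → MvPolynomial V K) :=
    LinearMap.funLeft (MvPolynomial V K) (MvPolynomial V K) (Fin.castAdd m)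
  let pr : (Fin (n + m) → MvPolynomial V K) →ₗ[MvPolynomial V K] (Fin m → MvPolynomial V K) :=
    LinearMap.funLeft (MvPolynomial V K) (MvPolynomial V K) (Fin.natAdd n)
  let il : (Fin n → MvPolynomial V K) →ₗ[MvPolynomial V K] (Fin (n + m) → MvPolynomial V K) :=
    LinearMap.pi (Fin.addCases (fun i => LinearMap.proj i) (fun _ => 0))
  have hpl : ∀ u v, pl (Fin.append u v) = u := fun u v => by
    funext i; simp [pl, LinearMap.funLeft_apply]
  have hpr : ∀ u v, pr (Fin.append u v) = v := fun u v => by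
    funext i; simp [pr, LinearMap.funLeft_apply]
  have hil : ∀ u, il u = Fin.append u 0 := fun u => by
    funext i
    refine Fin.addCases (fun i => ?_) (fun i => ?_) i <;> simp [il]
  let θ : (Fin (n + m) → MvPolynomial V K) →ₗ[MvPolynomial V K] B.carrier :=
    f ∘ₗ φ ∘ₗ pl + χ ∘ₗ pr
  have hθ : ∀ v, θ v = f (φ (pl v)) + χ (pr v) := fun v => rfl
  have hgθ : ∀ v, g (θ v) = ψ (pr v) := fun v => by
    rw [hθ, map_add, hfg.comp, zero_add, hχ']
  have hplp : ∀ j v, v ∈ (free (K := K) (V := V) (Fin.append a c)).piece j →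
      pl v ∈ (free (K := K) (V := V) a).piece j := by
    intro j v hv l
    have := hv (Fin.castAdd m l)
    rwa [Fin.append_left] at this
  have hprp : ∀ j v, v ∈ (free (K := K) (V := V) (Fin.append a c)).piece j →
      pr v ∈ (free (K := K) (V := V) c).piece j := by
    intro j v hv l
    have := hv (Fin.natAdd n l)
    rwa [Fin.append_right] at this
  have happ : ∀ j u v, u ∈ (free (K := K) (V := V) a).piece j →
      v ∈ (free (K := K) (V := V) c).piece j →
      Fin.append u v ∈ (free (K := K) (V := V) (Fin.append a c)).piece j := by
    intro j u v hu hv l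
    refine Fin.addCases (fun i => ?_) (fun i => ?_) l
    · simpa using hu i
    · simpa using hv i
  have hlift : ∀ j, ∀ x ∈ B.piece j, ∀ v ∈ (free (K := K) (V := V) c).piece j, g x = ψ v →
      ∃ u ∈ (free (K := K) (V := V) a).piece j, θ (Fin.append u v) = x := by
    intro j x hx v hv hxv
    obtain ⟨y, hy⟩ := hfg.exact (x - χ v) (by rw [map_sub, hxv, hχ', sub_self])
    have hyp : y ∈ A.piece j := by
      rw [← hfg.piece_iff, hy]
      exact sub_mem hx (hχp j v hv)
    obtain ⟨u, hu, huy⟩ := hφ3 j y hyp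
    refine ⟨u, hu, ?_⟩
    rw [hθ, hpl, hpr, huy, hy, sub_add_cancel]
  refine ⟨n + m, Fin.append a c, θ, ?_, ?_, ?_, ?_, ?_⟩
  · intro k
    refine Fin.addCases (fun i => ?_) (fun i => ?_) k
    · simpa using hφ1 i
    · simpa using hψ1 i
  · intro j v hv
    exact add_mem ((hfg.piece_iff _ _).2 (hφ2 _ _ (hplp j v hv))) (hχp _ _ (hprp j v hv))
  · intro j x hx
    obtain ⟨v, hv, hvx⟩ := hψ3 j _ (hfg.map j x hx)
    obtain ⟨u, hu, hux⟩ := hlift j x hx v hv hvx.symm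
    exact ⟨_, happ j u v hu hv, hux⟩
  · intro x
    obtain ⟨v, hv⟩ := hψ4 (g x)
    obtain ⟨y, hy⟩ := hfg.exact (x - χ v) (by rw [map_sub, hχ', hv, sub_self])
    obtain ⟨u, rfl⟩ := hφ4 y
    refine ⟨Fin.append u v, ?_⟩
    rw [hθ, hpl, hpr, hy, sub_add_cancel]
  · have h1 : ∀ u ∈ LinearMap.ker φ, il u ∈ LinearMap.ker θ := by
      intro u hu
      rw [LinearMap.mem_ker, hil, hθ, hpl, hpr, LinearMap.mem_ker.1 hu, map_zero, map_zero,
        add_zero]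
    have h2 : ∀ v ∈ LinearMap.ker θ, pr v ∈ LinearMap.ker ψ := by
      intro v hv
      rw [LinearMap.mem_ker, ← hgθ, LinearMap.mem_ker.1 hv, map_zero]
    refine ⟨(free a).sub (LinearMap.ker φ), (free c).sub (LinearMap.ker ψ),
      il.restrict h1, pr.restrict h2, ?_, hφ5, hψ5⟩
    refine ⟨?_, ?_, ?_, ?_, ?_, ?_, ?_⟩
    · rintro ⟨u, hu⟩ ⟨v, hv⟩ huv
      have : il u = il v := congrArg Subtype.val huv
      rw [hil, hil] at this
      have h3 := congrArg pl this
      rw [hpl, hpl] at h3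
      exact Subtype.ext h3
    · rintro ⟨u, hu⟩
      refine Subtype.ext ?_
      change pr (il u) = 0
      rw [hil, hpr]
    · rintro ⟨v, hv⟩ hv0
      have h3 : pr v = 0 := congrArg Subtype.val hv0
      have h4 : φ (pl v) = 0 := by
        apply hfg.inj
        have := LinearMap.mem_ker.1 hv
        rw [hθ, h3, map_zero, add_zero] at this
        rw [this, map_zero]
      refine ⟨⟨pl v, h4⟩, Subtype.ext ?_⟩
      change il (pl v) = v
      rw [hil]
      funext i
      refine Fin.addCases (fun i => ?_) (fun i => ?_) i
      · simp [pl, LinearMap.funLeft_apply]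
      · have := congrFun h3 i
        simpa [pr, LinearMap.funLeft_apply] using this.symm
    · rintro j ⟨u, hu⟩
      change il u ∈ (free (K := K) (V := V) (Fin.append a c)).piece j ↔
        u ∈ (free (K := K) (V := V) a).piece j
      rw [hil]
      refine ⟨fun h => ?_, fun h => happ j u 0 h (zero_mem _)⟩
      have := hplp j _ h
      rwa [hpl] at this
    · rintro j ⟨v, hv⟩ hvp
      exact hprp j v hvp
    · rintro j ⟨v, hv⟩ hvp
      obtain ⟨u, hu, hu0⟩ := hlift j 0 (zero_mem _) v hvp
        (by rw [map_zero]; exact (LinearMap.mem_ker.1 hv).symm)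
      exact ⟨⟨Fin.append u v, hu0⟩, happ j u v hu hvp, Subtype.ext (hpr u v)⟩
    · rintro ⟨v, hv⟩
      obtain ⟨y, hy⟩ := hfg.exact (χ v) (by rw [hχ']; exact hv)
      obtain ⟨u, rfl⟩ := hφ4 y
      refine ⟨⟨Fin.append (-u) v, ?_⟩, Subtype.ext (hpr _ v)⟩
      rw [LinearMap.mem_ker, hθ, hpl, hpr, map_neg, map_neg, hy, neg_add_cancel]

/-- The mapping cone: a quotient of a module of regularity at most `r` by a submodule of
regularity at most `r + 1` has regularity at most `r`. -/
theorem RegLE.cone {A B C : GrMod K V} {f : A.carrier →ₗ[MvPolynomial V K] B.carrier}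
    {g : B.carrier →ₗ[MvPolynomial V K] C.carrier} (hfg : IsSES f g) {r : ℕ}
    (hA : RegLE A (r + 1)) (hB : RegLE B r) : RegLE C r := by
  obtain ⟨n, b, φ, h1, h2, h3, h4, h5⟩ := hB.coverStep
  refine RegLE.of_coverStep ⟨n, b, g ∘ₗ φ, h1, fun j v hv => hfg.map _ _ (h2 j v hv), ?_,
    hfg.surj.comp h4, ?_⟩
  · intro j x hx
    obtain ⟨y, hy, rfl⟩ := hfg.lift j x hx
    obtain ⟨v, hv, rfl⟩ := h3 j y hy
    exact ⟨v, hv, rfl⟩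
  · have hle : LinearMap.ker φ ≤ LinearMap.ker (g ∘ₗ φ) := LinearMap.ker_le_ker_comp _ _
    have hrange : ∀ v : LinearMap.ker (g ∘ₗ φ),
        (φ ∘ₗ (LinearMap.ker (g ∘ₗ φ)).subtype) v ∈ LinearMap.range f := by
      rintro ⟨v, hv⟩
      exact hfg.exact _ hv
    let ρ : LinearMap.ker (g ∘ₗ φ) →ₗ[MvPolynomial V K] A.carrier :=
      (LinearEquiv.ofInjective f hfg.inj).symm.toLinearMap ∘ₗ
        LinearMap.codRestrict _ (φ ∘ₗ (LinearMap.ker (g ∘ₗ φ)).subtype) hrange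
    have hρ : ∀ v, f (ρ v) = φ v.1 := by
      intro v
      have := LinearEquiv.apply_symm_apply (LinearEquiv.ofInjective f hfg.inj)
        (LinearMap.codRestrict _ (φ ∘ₗ (LinearMap.ker (g ∘ₗ φ)).subtype) hrange v)
      exact congrArg Subtype.val this
    refine RegLE.ext (A := (free b).sub (LinearMap.ker φ))
      (B := (free b).sub (LinearMap.ker (g ∘ₗ φ))) (f := Submodule.inclusion hle) (g := ρ)
      ?_ h5 hA
    refine ⟨Submodule.inclusion_injective _, ?_, ?_, fun j a => Iff.rfl, ?_, ?_, ?_⟩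
    · intro v
      apply hfg.inj
      rw [hρ, map_zero]
      exact v.2
    · intro v hv
      refine ⟨⟨v.1, ?_⟩, rfl⟩
      rw [LinearMap.mem_ker, ← hρ, hv, map_zero]
    · intro j v hv
      rw [← hfg.piece_iff, hρ]
      exact h2 j _ hv
    · intro j x hx
      obtain ⟨v, hv, hvx⟩ := h3 j _ ((hfg.piece_iff j x).2 hx)
      refine ⟨⟨v, ?_⟩, hv, ?_⟩
      · rw [LinearMap.mem_ker, LinearMap.comp_apply, hvx, hfg.comp]
      · apply hfg.inj
        rw [hρ, hvx]
    · intro x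
      obtain ⟨v, hv⟩ := h4 (f x)
      refine ⟨⟨v, ?_⟩, ?_⟩
      · rw [LinearMap.mem_ker, LinearMap.comp_apply, hv, hfg.comp]
      · apply hfg.inj
        rw [hρ, hv]

theorem regLE_ring (r : ℕ) : RegLE (ring K V) r := by
  refine RegLE.of_coverStep ⟨1, fun _ => 0, LinearMap.proj 0, fun _ => Nat.zero_le _, ?_, ?_,
    ?_, RegLE.of_subsingleton ?_ _⟩
  · intro j v hv
    have := hv 0
    rwa [Nat.cast_zero, sub_zero] at this
  · intro j a ha
    refine ⟨fun _ => a, fun _ => ?_, rfl⟩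
    rw [Nat.cast_zero, sub_zero]
    exact ha
  · exact fun a => ⟨fun _ => a, rfl⟩
  · refine ⟨fun u v => Subtype.ext (funext fun k => ?_)⟩
    rw [Subsingleton.elim k 0]
    exact (LinearMap.mem_ker.1 u.2).trans (LinearMap.mem_ker.1 v.2).symm

theorem RegLE.prod {A C : GrMod K V} {r : ℕ} (hA : RegLE A r) (hC : RegLE C r) :
    RegLE (A.prod C) r := by
  refine RegLE.ext (f := LinearMap.inl _ A.carrier C.carrier)
    (g := LinearMap.snd _ A.carrier C.carrier) ?_ hA hC
  refine ⟨LinearMap.inl_injective, fun _ => rfl, ?_, ?_, fun j b hb => hb.2,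
    fun j c hc => ⟨(0, c), ⟨zero_mem _, hc⟩, rfl⟩, LinearMap.snd_surjective⟩
  · rintro ⟨a, c⟩ hc
    exact ⟨a, Prod.ext rfl hc.symm⟩
  · exact fun j a => ⟨fun h => h.1, fun h => ⟨h, zero_mem _⟩⟩

end GrMod

/-- A stage in the construction of a graded free resolution: a graded free module together
with a submodule of syzygies of bounded regularity. -/
structure SyzygyStage (K : Type) [Field K] (V : Type) where
  /-- The rank of the free module. -/
  rank : ℕ
  /-- The degrees of the generators of the free module. -/
  deg : Fin rank → ℕ
  /-- The submodule of syzygies. -/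
  syz : Submodule (MvPolynomial V K) (Fin rank → MvPolynomial V K)
  /-- The bound on the regularity. -/
  bound : ℕ
  regLE : GrMod.RegLE ((GrMod.free deg).sub syz) bound

theorem SyzygyStage.exists_next {K : Type} [Field K] {V : Type} (s : SyzygyStage K V) :
    ∃ (t : SyzygyStage K V)
      (f : (Fin t.rank → MvPolynomial V K) →ₗ[MvPolynomial V K]
        (Fin s.rank → MvPolynomial V K)),
      t.bound = s.bound + 1 ∧ (∀ k, t.deg k ≤ s.bound) ∧
      (∀ k l, IsHomog ((t.deg k : ℤ) - s.deg l) (f (Pi.single k 1) l)) ∧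
      LinearMap.range f = s.syz ∧ LinearMap.ker f = t.syz := by
  obtain ⟨n, d, φ, h1, h2, h3, h4, h5⟩ := s.regLE.coverStep
  refine ⟨⟨n, d, LinearMap.ker φ, s.bound + 1, h5⟩, s.syz.subtype ∘ₗ φ, rfl, h1, ?_, ?_, ?_⟩
  · intro k l
    exact h2 _ _ (GrMod.single_mem_free d k) l
  · rw [LinearMap.range_comp, LinearMap.range_eq_top.2 h4, Submodule.map_top,
      Submodule.range_subtype]
  · exact LinearMap.ker_comp_of_ker_eq_bot _ (Submodule.ker_subtype _)

theorem GrMod.RegLE.hasResolutionDegreeBound {K : Type} [Field K] {V : Type}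
    {I : Ideal (MvPolynomial V K)} {r : ℕ} (h : GrMod.RegLE (GrMod.ofIdeal I) r) :
    HasResolutionDegreeBound K I r := by
  obtain ⟨n, d, φ, h1, h2, h3, h4, h5⟩ := h.coverStep
  choose next f hbound hdeg hhom hrange hker using SyzygyStage.exists_next (K := K) (V := V)
  let st : ℕ → SyzygyStage K V := fun i =>
    Nat.rec ⟨n, d, LinearMap.ker φ, r + 1, h5⟩ (fun _ s => next s) i
  have hst : ∀ i, (st i).bound = r + 1 + i := by
    intro i
    induction i with
    | zero => rfl
    | succ i ih => exact (hbound (st i)).trans (by rw [ih]; rfl)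
  refine ⟨fun i => (st i).rank, fun i => (st i).deg, fun i => f (st i),
    I.subtype ∘ₗ φ, ?_, ?_, ?_, ?_, ?_, ?_⟩
  · intro k
    exact IsHomog.isHomogeneous (h2 _ _ (GrMod.single_mem_free d k))
  · intro i k l
    have h := hhom (st i) k l
    by_cases hlt : (st (i + 1)).deg k < (st i).deg l
    · have h0 := h.eq_zero (by have : (next (st i)).deg k < (st i).deg l := hlt
                               omega)
      refine ⟨?_, fun _ => h0⟩
      rw [h0]
      exact MvPolynomial.isHomogeneous_zero _ _ _
    · refine ⟨IsHomog.isHomogeneous ?_, fun hlt' => absurd hlt' hlt⟩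
      rw [Nat.cast_sub (not_lt.1 hlt)]
      exact h
  · rw [LinearMap.range_comp, LinearMap.range_eq_top.2 h4, Submodule.map_top,
      Submodule.range_subtype]
  · rw [hrange (st 0)]
    exact (LinearMap.ker_comp_of_ker_eq_bot φ (Submodule.ker_subtype I)).symm
  · intro i
    exact (hrange (next (st i))).trans (hker (st i)).symm
  · intro i k
    cases i with
    | zero => exact (h1 k).trans (by omega)
    | succ i =>
      have := hdeg (st i) k
      rw [hst] at this
      exact this.trans (by omega)

section Monomial

variable {K : Type} [Field K] {V : Type}

/-- The monomial ideal generated by the monomials with exponent in `U`. -/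
noncomputable def monoIdeal (K : Type) [Field K] {V : Type} (U : Set (V →₀ ℕ)) :
    Ideal (MvPolynomial V K) :=
  Ideal.span ((fun m => MvPolynomial.monomial m (1 : K)) '' U)

theorem mem_monoIdeal {U : Set (V →₀ ℕ)} (hU : IsUpperSet U) {p : MvPolynomial V K} :
    p ∈ monoIdeal K U ↔ ∀ m ∈ p.support, m ∈ U := by
  rw [monoIdeal, MvPolynomial.mem_ideal_span_monomial_image]
  refine forall₂_congr fun m _ => ⟨?_, fun h => ⟨m, h, le_rfl⟩⟩
  rintro ⟨n, hn, hnm⟩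
  exact hU hnm hn

/-- The monomial ideal of `U` has regularity at most `r`. -/
def RegU (K : Type) [Field K] {V : Type} (U : Set (V →₀ ℕ)) (r : ℕ) : Prop :=
  GrMod.RegLE (GrMod.ofIdeal (monoIdeal K U)) r

theorem RegU.mono {U : Set (V →₀ ℕ)} {r s : ℕ} (h : RegU K U r) (hrs : r ≤ s) : RegU K U s :=
  GrMod.RegLE.mono h hrs

theorem regU_empty (r : ℕ) : RegU K (∅ : Set (V →₀ ℕ)) r := by
  refine GrMod.RegLE.of_subsingleton ⟨fun a b => Subtype.ext ?_⟩ r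
  have h : ∀ a : monoIdeal K (∅ : Set (V →₀ ℕ)), a.1 = 0 := by
    intro a
    have h1 := a.2
    simpa [monoIdeal] using h1
  rw [h a, h b]

/-- The exponents `n` with `n + m ∈ U`. -/
def colonSet (U : Set (V →₀ ℕ)) (m : V →₀ ℕ) : Set (V →₀ ℕ) := {n | n + m ∈ U}

theorem isUpperSet_colonSet {U : Set (V →₀ ℕ)} (hU : IsUpperSet U) (m : V →₀ ℕ) :
    IsUpperSet (colonSet U m) := fun _ _ hab ha => hU (add_le_add_left hab m) ha

theorem monomial_mul_mem_iff {U : Set (V →₀ ℕ)} (hU : IsUpperSet U) (m : V →₀ ℕ)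
    (p : MvPolynomial V K) :
    MvPolynomial.monomial m 1 * p ∈ monoIdeal K U ↔ p ∈ monoIdeal K (colonSet U m) := by
  rw [mem_monoIdeal hU, mem_monoIdeal (isUpperSet_colonSet hU m)]
  constructor
  · intro h n hn
    refine h (n + m) ?_
    rw [MvPolynomial.mem_support_iff, add_comm, MvPolynomial.coeff_monomial_mul, one_mul]
    exact MvPolynomial.mem_support_iff.1 hn
  · intro h n hn
    rw [MvPolynomial.mem_support_iff, MvPolynomial.coeff_monomial_mul'] at hn
    split_ifs at hn with hmn
    · have := h (n - m) (MvPolynomial.mem_support_iff.2 (by simpa using hn))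
      have h2 : n - m + m ∈ U := this
      rwa [tsub_add_cancel_of_le hmn] at h2
    · exact absurd rfl hn

theorem IsHomog.divMonomial {j : ℤ} {p : MvPolynomial V K} (hp : IsHomog j p) (m : V →₀ ℕ) :
    IsHomog (j - (m.degree : ℕ)) (p.divMonomial m) := by
  intro n hn
  rw [MvPolynomial.mem_support_iff, MvPolynomial.coeff_divMonomial] at hn
  have := hp _ (MvPolynomial.mem_support_iff.2 hn)
  rw [map_add, Nat.cast_add] at this
  linarith

theorem mem_support_modMonomial {p : MvPolynomial V K} {m n : V →₀ ℕ}
    (hn : n ∈ (p.modMonomial m).support) : n ∈ p.support ∧ ¬ m ≤ n := by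
  rw [MvPolynomial.mem_support_iff] at hn
  by_cases h : m ≤ n
  · exact absurd (MvPolynomial.coeff_modMonomial_of_le _ h) hn
  · rw [MvPolynomial.coeff_modMonomial_of_not_le _ h] at hn
    exact ⟨MvPolynomial.mem_support_iff.2 hn, h⟩

theorem isUpperSet_union_Ici {U : Set (V →₀ ℕ)} (hU : IsUpperSet U) (m : V →₀ ℕ) :
    IsUpperSet (U ∪ Set.Ici m) := hU.union (isUpperSet_Ici m)

/-- The short exact sequence `0 → (U : m)(-|m|) → U ⊕ S(-|m|) → U + (m) → 0`. -/
theorem exists_isSES_colon {U : Set (V →₀ ℕ)} (hU : IsUpperSet U) (m : V →₀ ℕ) :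
    ∃ (f : ((GrMod.ofIdeal (monoIdeal K (colonSet U m))).shift m.degree).carrier
        →ₗ[MvPolynomial V K] ((GrMod.ofIdeal (monoIdeal K U)).prod
          ((GrMod.ring K V).shift m.degree)).carrier)
      (g : ((GrMod.ofIdeal (monoIdeal K U)).prod ((GrMod.ring K V).shift m.degree)).carrier
        →ₗ[MvPolynomial V K] (GrMod.ofIdeal (monoIdeal K (U ∪ Set.Ici m))).carrier),
      GrMod.IsSES f g := by
  have hU' := isUpperSet_union_Ici hU m
  have hle : monoIdeal K U ≤ monoIdeal K (U ∪ Set.Ici m) :=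
    Ideal.span_mono (Set.image_mono Set.subset_union_left)
  have hm : MvPolynomial.monomial m (1 : K) ∈ monoIdeal K (U ∪ Set.Ici m) :=
    Ideal.subset_span ⟨m, Or.inr (le_refl m), rfl⟩
  let f : monoIdeal K (colonSet U m) →ₗ[MvPolynomial V K]
      (monoIdeal K U) × MvPolynomial V K :=
    { toFun := fun u => (⟨MvPolynomial.monomial m 1 * u.1,
        (monomial_mul_mem_iff hU m u.1).2 u.2⟩, -u.1)
      map_add' := fun u v => Prod.ext (Subtype.ext (mul_add _ _ _)) (neg_add _ _)
      map_smul' := fun c u => Prod.ext (Subtype.ext (mul_left_comm _ _ _))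
        (mul_neg c u.1).symm }
  let g : ((monoIdeal K U) × MvPolynomial V K) →ₗ[MvPolynomial V K]
      monoIdeal K (U ∪ Set.Ici m) :=
    { toFun := fun a => ⟨a.1.1 + MvPolynomial.monomial m 1 * a.2,
        add_mem (hle a.1.2) (Ideal.mul_mem_right _ _ hm)⟩
      map_add' := fun a b => Subtype.ext (by
        change a.1.1 + b.1.1 + MvPolynomial.monomial m 1 * (a.2 + b.2) =
          (a.1.1 + MvPolynomial.monomial m 1 * a.2) + (b.1.1 + MvPolynomial.monomial m 1 * b.2)
        ring)
      map_smul' := fun c a => Subtype.ext (by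
        change c * a.1.1 + MvPolynomial.monomial m 1 * (c * a.2) =
          c * (a.1.1 + MvPolynomial.monomial m 1 * a.2)
        ring) }
  have hlift : ∀ c : monoIdeal K (U ∪ Set.Ici m),
      ∃ h : c.1.modMonomial m ∈ monoIdeal K U, g (⟨_, h⟩, c.1.divMonomial m) = c := by
    intro c
    have h : c.1.modMonomial m ∈ monoIdeal K U := by
      rw [mem_monoIdeal hU]
      intro n hn
      obtain ⟨h1, h2⟩ := mem_support_modMonomial hn
      exact ((mem_monoIdeal hU').1 c.2 n h1).resolve_right h2
    refine ⟨h, Subtype.ext ?_⟩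
    change c.1.modMonomial m + MvPolynomial.monomial m 1 * c.1.divMonomial m = c.1
    rw [add_comm]
    exact MvPolynomial.divMonomial_add_modMonomial _ _
  refine ⟨f, g, ?_, ?_, ?_, ?_, ?_, ?_, ?_⟩
  · intro u v huv
    have h : -u.1 = -v.1 := congrArg Prod.snd huv
    exact Subtype.ext (neg_injective h)
  · intro u
    refine Subtype.ext ?_
    change MvPolynomial.monomial m 1 * u.1 + MvPolynomial.monomial m 1 * -u.1 = 0
    ring
  · rintro ⟨⟨a, ha⟩, b⟩ hab
    have h : a + MvPolynomial.monomial m 1 * b = 0 := congrArg Subtype.val hab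
    have h' : a = MvPolynomial.monomial m 1 * -b := by
      rw [mul_neg]; exact eq_neg_of_add_eq_zero_left h
    refine ⟨⟨-b, ?_⟩, Prod.ext (Subtype.ext h'.symm) (neg_neg b)⟩
    rw [← monomial_mul_mem_iff hU, ← h']
    exact ha
  · intro j u
    change (IsHomog j (MvPolynomial.monomial m 1 * u.1) ∧ IsHomog (j - (m.degree : ℕ)) (-u.1)) ↔
      IsHomog (j - (m.degree : ℕ)) u.1
    constructor
    · intro h
      simpa using h.2.neg
    · intro h
      refine ⟨?_, h.neg⟩
      have := (isHomog_monomial m (1 : K)).mul h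
      rwa [add_sub_cancel] at this
  · rintro j ⟨a, b⟩ ⟨ha, hb⟩
    have := (isHomog_monomial m (1 : K)).mul (show IsHomog (j - (m.degree : ℕ)) b from hb)
    rw [add_sub_cancel] at this
    exact IsHomog.add ha this
  · intro j c hc
    obtain ⟨h, hc'⟩ := hlift c
    refine ⟨(⟨_, h⟩, c.1.divMonomial m), ⟨?_, IsHomog.divMonomial hc m⟩, hc'⟩
    exact fun n hn => hc n (mem_support_modMonomial hn).1
  · intro c
    obtain ⟨h, hc'⟩ := hlift c
    exact ⟨_, hc'⟩

theorem regLE_ring_shift {d r : ℕ} (h : d ≤ r) :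
    GrMod.RegLE ((GrMod.ring K V).shift d) r :=
  ((GrMod.regLE_ring 0).shift d).mono (by omega)

theorem RegU.of_colon {U : Set (V →₀ ℕ)} (hU : IsUpperSet U) (m : V →₀ ℕ) {r₀ r : ℕ}
    (h1 : RegU K (colonSet U m) r₀) (h2 : RegU K (U ∪ Set.Ici m) r)
    (h : r₀ + m.degree ≤ r) : RegU K U r := by
  obtain ⟨f, g, hfg⟩ := exists_isSES_colon (K := K) hU m
  have hB := GrMod.RegLE.ext hfg ((h1.shift m.degree).mono h) h2
  have hS : GrMod.RegLE ((GrMod.ring K V).shift m.degree) (r + 1) :=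
    regLE_ring_shift (by omega)
  refine GrMod.RegLE.cone
    (f := LinearMap.inr (MvPolynomial V K) (monoIdeal K U) (MvPolynomial V K))
    (g := LinearMap.fst (MvPolynomial V K) (monoIdeal K U) (MvPolynomial V K)) ?_ hS hB
  refine ⟨LinearMap.inr_injective, fun _ => rfl, ?_, ?_, fun j b hb => hb.1,
    fun j c hc => ⟨(c, 0), ⟨hc, zero_mem _⟩, rfl⟩, LinearMap.fst_surjective⟩
  · rintro ⟨a, c⟩ hc
    exact ⟨c, Prod.ext hc.symm rfl⟩
  · exact fun j a => ⟨fun h => h.2, fun h => ⟨zero_mem _, h⟩⟩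

theorem RegU.union_Ici {U : Set (V →₀ ℕ)} (hU : IsUpperSet U) (m : V →₀ ℕ) {r₀ r : ℕ}
    (h1 : RegU K U r) (h2 : RegU K (colonSet U m) r₀) (h : r₀ + m.degree ≤ r + 1)
    (hm : m.degree ≤ r) : RegU K (U ∪ Set.Ici m) r := by
  obtain ⟨f, g, hfg⟩ := exists_isSES_colon (K := K) hU m
  exact GrMod.RegLE.cone hfg ((GrMod.RegLE.shift h2 m.degree).mono h)
    (GrMod.RegLE.prod h1 (regLE_ring_shift hm))

end Monomial

section FLe

variable {V : Type}

/-- A recursive upper bound for the regularity of the "graph" with edge relation `H`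
restricted to `W`: at a vertex `z` one compares the deletion of `z` and the deletion of
its neighbors. -/
inductive FLe (H : V → V → Prop) : Set V → ℕ → Prop
  | edgeless (W : Set V) (b : ℕ) (h : ∀ u ∈ W, ∀ v ∈ W, ¬ H u v) : FLe H W b
  | step (z : V) (W : Set V) (b : ℕ) (hz : z ∈ W) (h1 : FLe H (W \ {z}) (b + 1))
      (h2 : FLe H (W \ {w | H z w}) b) : FLe H W (b + 1)

theorem FLe.subset {H : V → V → Prop} {W : Set V} {b : ℕ} (h : FLe H W b) :
    ∀ {W' : Set V}, W' ⊆ W → FLe H W' b := by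
  induction h with
  | edgeless W b h =>
    intro W' hW
    exact FLe.edgeless _ _ fun u hu v hv => h u (hW hu) v (hW hv)
  | step z W b hz _ _ ih1 ih2 =>
    intro W' hW
    by_cases hz' : z ∈ W'
    · exact FLe.step z W' b hz' (ih1 (Set.sdiff_subset_sdiff_left hW))
        (ih2 (Set.sdiff_subset_sdiff_left hW))
    · refine ih1 fun w hw => ⟨hW hw, ?_⟩
      rintro rfl
      exact hz' hw

theorem FLe.succ {H : V → V → Prop} {W : Set V} {b : ℕ} (h : FLe H W b) :
    FLe H W (b + 1) := by
  induction h with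
  | edgeless W b h => exact FLe.edgeless _ _ h
  | step z W b hz _ _ ih1 ih2 => exact FLe.step z W (b + 1) hz ih1 ih2

theorem FLe.mono {H : V → V → Prop} {W : Set V} {b c : ℕ} (h : FLe H W b) (hbc : b ≤ c) :
    FLe H W c := by
  induction hbc with
  | refl => exact h
  | step _ ih => exact ih.succ

/-- The exponents divisible by a variable outside `W` or by an edge of `H`. -/
def edgeSetU (H : V → V → Prop) (W : Set V) : Set (V →₀ ℕ) :=
  {n | (∃ x, x ∉ W ∧ 1 ≤ n x) ∨
    ∃ a b, H a b ∧ Finsupp.single a 1 + Finsupp.single b 1 ≤ n}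

theorem isUpperSet_edgeSetU (H : V → V → Prop) (W : Set V) : IsUpperSet (edgeSetU H W) := by
  rintro m n hmn (⟨x, hx, h⟩ | ⟨a, b, hab, h⟩)
  · exact Or.inl ⟨x, hx, h.trans (hmn x)⟩
  · exact Or.inr ⟨a, b, hab, h.trans hmn⟩

theorem single_le_iff_one_le {n : V →₀ ℕ} {x : V} : Finsupp.single x 1 ≤ n ↔ 1 ≤ n x :=
  Finsupp.single_le_iff

theorem regU_variables {K : Type} [Field K] (X : Set V) (hX : X.Finite) :
    RegU K {n : V →₀ ℕ | ∃ x ∈ X, 1 ≤ n x} 1 := by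
  classical
  induction X, hX using Set.Finite.induction_on with
  | empty => simpa using regU_empty (K := K) (V := V) 1
  | @insert x X hx _ ih =>
    have hup : IsUpperSet {n : V →₀ ℕ | ∃ x ∈ X, 1 ≤ n x} := by
      rintro m n hmn ⟨y, hy, h⟩
      exact ⟨y, hy, h.trans (hmn y)⟩
    have hcol : colonSet {n : V →₀ ℕ | ∃ x ∈ X, 1 ≤ n x} (Finsupp.single x 1) =
        {n : V →₀ ℕ | ∃ x ∈ X, 1 ≤ n x} := by
      ext n
      refine exists_congr fun y => and_congr_right fun hy => ?_
      have : x ≠ y := by rintro rfl; exact hx hy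
      rw [Finsupp.add_apply, Finsupp.single_eq_of_ne this.symm, add_zero]
    have := RegU.union_Ici hup (Finsupp.single x 1) ih (r₀ := 1) (by rwa [hcol]) (by simp)
      (by simp)
    convert this using 1
    ext n
    simp only [Set.mem_ofPred_eq, Set.mem_insert_iff, Set.mem_union, Set.mem_Ici,
      single_le_iff_one_le]
    constructor
    · rintro ⟨y, rfl | hy, h⟩
      exacts [Or.inr h, Or.inl ⟨y, hy, h⟩]
    · rintro (⟨y, hy, h⟩ | h)
      exacts [⟨y, Or.inr hy, h⟩, ⟨x, Or.inl rfl, h⟩]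

theorem FLe.regU {K : Type} [Field K] [Finite V] {H : V → V → Prop}
    (hH : ∀ a b, H a b → H b a) {W : Set V} {b : ℕ} (h : FLe H W b) :
    RegU K (edgeSetU H W) (b + 1) := by
  classical
  induction h with
  | edgeless W b h =>
    refine RegU.mono (r := 1) ?_ (by omega)
    convert regU_variables (K := K) Wᶜ (Set.toFinite _) using 1
    ext n
    constructor
    · rintro (⟨x, hx, hn⟩ | ⟨u, v, huv, hn⟩)
      · exact ⟨x, hx, hn⟩
      · by_cases hu : u ∈ W
        · by_cases hv : v ∈ W
          · exact absurd huv (h u hu v hv)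
          · refine ⟨v, hv, ?_⟩
            have := hn v
            simp only [Finsupp.add_apply, Finsupp.single_eq_same] at this
            omega
        · refine ⟨u, hu, ?_⟩
          have := hn u
          simp only [Finsupp.add_apply, Finsupp.single_eq_same] at this
          omega
    · rintro ⟨x, hx, hn⟩
      exact Or.inl ⟨x, hx, hn⟩
  | step z W b hz _ _ ih1 ih2 =>
    refine RegU.of_colon (isUpperSet_edgeSetU H W) (Finsupp.single z 1) (r₀ := b + 1) ?_ ?_
      (by simp)
    · convert ih2 using 1
      ext n
      constructor
      · rintro (⟨x, hx, hn⟩ | ⟨u, v, huv, hn⟩)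
        · have : z ≠ x := by rintro rfl; exact hx hz
          rw [Finsupp.add_apply, Finsupp.single_eq_of_ne this.symm, add_zero] at hn
          exact Or.inl ⟨x, fun h => hx h.1, hn⟩
        · by_cases hu : u = z
          · subst hu
            rw [add_comm] at hn
            refine Or.inl ⟨v, fun h => h.2 huv, ?_⟩
            exact single_le_iff_one_le.1 ((add_le_add_iff_right _).1 hn)
          · by_cases hv : v = z
            · subst hv
              refine Or.inl ⟨u, fun h => h.2 (hH _ _ huv), ?_⟩
              exact single_le_iff_one_le.1 ((add_le_add_iff_right _).1 hn)
            · refine Or.inr ⟨u, v, huv, fun y => ?_⟩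
              by_cases hy : y = z
              · subst hy
                rw [Finsupp.add_apply, Finsupp.single_eq_of_ne (Ne.symm hu),
                  Finsupp.single_eq_of_ne (Ne.symm hv)]
                exact Nat.zero_le _
              · have := hn y
                rwa [Finsupp.add_apply n, Finsupp.single_eq_of_ne hy, add_zero] at this
      · rintro (⟨x, hx, hn⟩ | ⟨u, v, huv, hn⟩)
        · by_cases hxW : x ∈ W
          · have hzx : H z x := by
              by_contra h
              exact hx ⟨hxW, h⟩
            refine Or.inr ⟨x, z, hH _ _ hzx, ?_⟩
            exact (add_le_add_iff_right _).2 (single_le_iff_one_le.2 hn)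
          · refine Or.inl ⟨x, hxW, ?_⟩
            rw [Finsupp.add_apply]
            omega
        · exact Or.inr ⟨u, v, huv, hn.trans le_self_add⟩
    · convert ih1 using 1
      ext n
      simp only [Set.mem_union, Set.mem_Ici, single_le_iff_one_le]
      constructor
      · rintro ((⟨x, hx, hn⟩ | h) | h)
        · exact Or.inl ⟨x, fun h => hx h.1, hn⟩
        · exact Or.inr h
        · exact Or.inl ⟨z, fun h => h.2 rfl, h⟩
      · rintro (⟨x, hx, hn⟩ | h)
        · by_cases hxz : x = z
          · subst hxz
            exact Or.inr hn
          · exact Or.inl (Or.inl ⟨x, fun h => hx ⟨h, hxz⟩, hn⟩)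
        · exact Or.inl (Or.inr h)

end FLe

section EvenConnection

variable {V : Type}

theorem FLe.congr {H H' : V → V → Prop} {W : Set V} {b : ℕ} (h : FLe H W b) :
    (∀ u ∈ W, ∀ v ∈ W, H u v ↔ H' u v) → FLe H' W b := by
  induction h with
  | edgeless W b h =>
    intro hH
    exact FLe.edgeless _ _ fun u hu v hv huv => h u hu v hv ((hH u hu v hv).2 huv)
  | step z W b hz _ _ ih1 ih2 =>
    intro hH
    refine FLe.step z W b hz (ih1 fun u hu v hv => hH u hu.1 v hv.1) ?_
    have : W \ {w | H' z w} = W \ {w | H z w} := by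
      ext w
      exact and_congr_right fun hw => not_congr (hH z hz w hw).symm
    rw [this]
    exact ih2 fun u hu v hv => hH u hu.1 v hv.1

theorem FLe.of_forall_diff {H : V → V → Prop} {X A : Set V} {b : ℕ} (hA : A.Finite)
    (h1 : ∀ a ∈ A, FLe H (X \ {w | H a w}) b) (h2 : FLe H (X \ A) (b + 1)) :
    FLe H X (b + 1) := by
  induction A, hA using Set.Finite.induction_on with
  | empty => simpa using h2
  | @insert a A _ _ ih =>
    refine ih (fun x hx => h1 x (Set.mem_insert_of_mem _ hx)) ?_
    have heq : (X \ A) \ {a} = X \ insert a A := by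
      ext w
      simp only [Set.mem_sdiff, Set.mem_insert_iff, Set.mem_singleton_iff]
      tauto
    by_cases ha : a ∈ X \ A
    · refine FLe.step a _ b ha (by rwa [heq]) ((h1 a (Set.mem_insert _ _)).subset ?_)
      exact Set.sdiff_subset_sdiff_left Set.sdiff_subset
    · rwa [← heq, Set.sdiff_singleton_eq_self ha] at h2

/-- `CN G M a b`: there is a walk from `a` to `b` of odd length, whose even-numbered edges
are exactly the members of `M` and whose other edges belong to `G`. -/
inductive CN (G : SimpleGraph V) : Multiset (Sym2 V) → V → V → Prop
  | base {a b : V} (h : G.Adj a b) : CN G 0 a b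
  | step {a b p q : V} {M : Multiset (Sym2 V)} (h : G.Adj a p) (h' : CN G M q b) :
      CN G (s(p, q) ::ₘ M) a b

variable {G : SimpleGraph V}

theorem CN.concat {M₁ M₂ : Multiset (Sym2 V)} {a b p q : V} (h1 : CN G M₁ a p)
    (h2 : CN G M₂ q b) : CN G (s(p, q) ::ₘ (M₁ + M₂)) a b := by
  induction h1 with
  | base h => rw [zero_add]; exact CN.step h h2
  | @step a p p' q' M h _ ih =>
    have := CN.step h ih
    rwa [Multiset.cons_swap, ← Multiset.cons_add] at this

theorem CN.symm {M : Multiset (Sym2 V)} {a b : V} (h : CN G M a b) : CN G M b a := by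
  induction h with
  | base h => exact CN.base h.symm
  | step h _ ih =>
    have := ih.concat (CN.base h.symm)
    rwa [add_zero, Sym2.eq_swap] at this

theorem CN.split {M : Multiset (Sym2 V)} {a b : V} (h : CN G M a b) {p q : V}
    (hpq : s(p, q) ∈ M) :
    ∃ M₁ M₂, M = s(p, q) ::ₘ (M₁ + M₂) ∧
      ((CN G M₁ a p ∧ CN G M₂ q b) ∨ (CN G M₁ a q ∧ CN G M₂ p b)) := by
  induction h with
  | base h => simp at hpq
  | @step a b p' q' M h h' ih =>
    rcases Multiset.mem_cons.1 hpq with heq | hmem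
    · refine ⟨0, M, by rw [heq, zero_add], ?_⟩
      rcases Sym2.eq_iff.1 heq with ⟨rfl, rfl⟩ | ⟨rfl, rfl⟩
      · exact Or.inl ⟨CN.base h, h'⟩
      · exact Or.inr ⟨CN.base h, h'⟩
    · obtain ⟨M₁, M₂, rfl, hM⟩ := ih hmem
      refine ⟨s(p', q') ::ₘ M₁, M₂, ?_, ?_⟩
      · rw [Multiset.cons_add, Multiset.cons_swap]
      · exact hM.imp (fun hM => ⟨CN.step h hM.1, hM.2⟩) fun hM => ⟨CN.step h hM.1, hM.2⟩

/-- Two vertices are even-connected with respect to `N` (allowing the trivial connection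
by an edge of `G`). -/
def EC (G : SimpleGraph V) (N : Multiset (Sym2 V)) (a b : V) : Prop :=
  ∃ M ≤ N, CN G M a b

theorem EC.symm {N : Multiset (Sym2 V)} {a b : V} : EC G N a b → EC G N b a := by
  rintro ⟨M, hM, h⟩
  exact ⟨M, hM, h.symm⟩

theorem EC.mono {N N' : Multiset (Sym2 V)} {a b : V} (hN : N ≤ N') : EC G N a b → EC G N' a b := by
  rintro ⟨M, hM, h⟩
  exact ⟨M, hM.trans hN, h⟩

theorem EC.of_adj {N : Multiset (Sym2 V)} {a b : V} (h : G.Adj a b) : EC G N a b :=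
  ⟨0, Multiset.zero_le _, CN.base h⟩

theorem EC.cons {N : Multiset (Sym2 V)} {a p q b : V} (h : G.Adj a p) :
    EC G N q b → EC G (s(p, q) ::ₘ N) a b := by
  rintro ⟨M, hM, h'⟩
  exact ⟨_, Multiset.cons_le_cons _ hM, CN.step h h'⟩

theorem CN.hit_or_disjoint {M P : Multiset (Sym2 V)} {a y c d : V} (h : CN G M a y)
    (hP : CN G P c d) : ∀ N, M ≤ N → P ≤ N →
    (EC G N a c ∨ EC G N a d) ∨ M + P ≤ N := by
  classical
  induction h with
  | base h => intro N _ hN; right; rwa [zero_add]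
  | @step a y p q M h h' ih =>
    intro N hMN hPN
    obtain ⟨N, rfl⟩ := Multiset.exists_cons_of_mem
      (Multiset.mem_of_le hMN (Multiset.mem_cons_self _ _))
    rw [Multiset.cons_le_cons_iff] at hMN
    by_cases hP' : P ≤ N
    · refine (ih N hMN hP').imp (fun h1 => h1.imp (EC.cons h) (EC.cons h)) fun h1 => ?_
      rw [Multiset.cons_add]
      exact Multiset.cons_le_cons _ h1
    · left
      have hmem : s(p, q) ∈ P := by
        by_contra hn
        exact hP' ((Multiset.le_cons_of_notMem hn).1 hPN)
      obtain ⟨P₁, P₂, rfl, ⟨_, h2⟩ | ⟨h1, _⟩⟩ := hP.split hmem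
      · right
        exact ⟨_, (Multiset.cons_le_cons _ (Multiset.le_add_left _ _)).trans hPN, CN.step h h2⟩
      · left
        exact ⟨_, (Multiset.cons_le_cons _ (Multiset.le_add_right _ _)).trans hPN,
          CN.step h h1.symm⟩

theorem CN.hit {M P N : Multiset (Sym2 V)} {a c d p q : V} (h : CN G M a p)
    (hP : CN G P c d) (hM : M ≤ N) (hPN : P ≤ N) (hpq : s(p, q) ∈ P) :
    EC G N a c ∨ EC G N a d := by
  refine (h.hit_or_disjoint hP N hM hPN).elim id fun hle => ?_
  obtain ⟨P₁, P₂, rfl, ⟨_, h2⟩ | ⟨h1, _⟩⟩ := hP.split hpq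
  · refine Or.inr ⟨_, le_trans ?_ hle, h.concat h2⟩
    rw [Multiset.add_cons]
    exact Multiset.cons_le_cons _ (add_le_add le_rfl (Multiset.le_add_left _ _))
  · refine Or.inl ⟨_, le_trans ?_ hle, h.concat h1.symm⟩
    rw [Multiset.add_cons]
    exact Multiset.cons_le_cons _ (add_le_add le_rfl (Multiset.le_add_right _ _))

theorem CN.hit_of_cons {M P N : Multiset (Sym2 V)} {a c d y z x : V} (h : CN G M a y)
    (hP : CN G P c d) (hM : s(z, y) ::ₘ M ≤ N) (hPN : P ≤ N) (hzx : s(z, x) ∈ P) :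
    EC G N a c ∨ EC G N a d := by
  by_cases hzy : s(z, y) ∈ P
  · exact h.hit hP ((Multiset.le_cons_self _ _).trans hM) hPN (q := z)
      (by rwa [Sym2.eq_swap])
  · obtain ⟨N, rfl⟩ := Multiset.exists_cons_of_mem
      (Multiset.mem_of_le hM (Multiset.mem_cons_self _ _))
    rw [Multiset.cons_le_cons_iff] at hM
    rw [Multiset.le_cons_of_notMem hzy] at hPN
    rcases h.hit_or_disjoint hP N hM hPN with hh | hle
    · exact hh.imp (EC.mono (Multiset.le_cons_self _ _)) (EC.mono (Multiset.le_cons_self _ _))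
    · obtain ⟨P₁, P₂, rfl, ⟨h1, _⟩ | ⟨_, h2⟩⟩ := hP.split hzx
      · have := h.concat h1.symm
        rw [Sym2.eq_swap] at this
        refine Or.inl ⟨_, Multiset.cons_le_cons _ (le_trans (add_le_add le_rfl ?_) hle), this⟩
        exact (Multiset.le_add_right _ _).trans (Multiset.le_cons_self _ _)
      · have := h.concat h2
        rw [Sym2.eq_swap] at this
        refine Or.inr ⟨_, Multiset.cons_le_cons _ (le_trans (add_le_add le_rfl ?_) hle), this⟩
        exact (Multiset.le_add_left _ _).trans (Multiset.le_cons_self _ _)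

theorem CN.notMem_of_edgeless {M : Multiset (Sym2 V)} {a b : V} (h : CN G M a b) {W : Set V}
    (hW : ∀ u ∈ W, ∀ v ∈ W, ¬ G.Adj u v) (hM : ∀ e ∈ M, ∃ v ∈ e, v ∈ W) (ha : a ∈ W) :
    b ∉ W := by
  induction h with
  | base h => exact fun hb => hW _ ha _ hb h
  | @step a b p q M h _ ih =>
    refine ih (fun e he => hM e (Multiset.mem_cons_of_mem he)) ?_
    obtain ⟨v, hv, hvW⟩ := hM s(p, q) (Multiset.mem_cons_self _ _)
    rcases Sym2.mem_iff.1 hv with rfl | rfl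
    · exact absurd h (hW _ ha _ hvW)
    · exact hvW

theorem FLe.evenConnection [Finite V] {W : Set V} {b : ℕ} (h : FLe G.Adj W b) :
    ∀ W' ⊆ W, ∀ N : Multiset (Sym2 V), (∀ e ∈ N, ¬ e.IsDiag) →
      (∀ e ∈ N, ∃ v ∈ e, v ∈ W') → FLe (EC G N) W' b := by
  classical
  have restrict : ∀ (W' : Set V) (N : Multiset (Sym2 V)) (c : ℕ),
      (∀ u ∈ W', ∀ v ∈ W', ∀ P ≤ N, CN G P u v → ∀ e ∈ P, ∃ x ∈ e, x ∈ W') →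
      FLe (EC G (N.filter fun e => ∃ x ∈ e, x ∈ W')) W' c → FLe (EC G N) W' c := by
    intro W' N c hP hF
    refine hF.congr fun u hu v hv => ⟨EC.mono (Multiset.filter_le _ _), ?_⟩
    rintro ⟨P, hPN, huv⟩
    exact ⟨P, Multiset.le_filter.2 ⟨hPN, hP u hu v hv P hPN huv⟩, huv⟩
  induction h with
  | edgeless W b h =>
    intro W' hW N _ hN
    refine FLe.edgeless _ _ ?_
    rintro u hu v hv ⟨M, hM, hcn⟩
    exact hcn.notMem_of_edgeless (fun x hx y hy => h x (hW hx) y (hW hy))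
      (fun e he => hN e (Multiset.mem_of_le hM he)) hu hv
  | step z W b hz _ _ ih1 ih2 =>
    intro W' hW N hd hN
    by_cases hzW : z ∈ W'
    swap
    · refine ih1 W' (fun w hw => ⟨hW hw, ?_⟩) N hd hN
      rintro rfl
      exact hzW hw
    have hdf : ∀ p : Sym2 V → Prop, ∀ e ∈ N.filter p, ¬ e.IsDiag := fun p e he =>
      hd e (Multiset.mem_of_mem_filter he)
    have hNf : ∀ W₁ : Set V, ∀ e ∈ N.filter (fun e => ∃ x ∈ e, x ∈ W₁), ∃ v ∈ e, v ∈ W₁ :=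
      fun W₁ e he => (Multiset.mem_filter.1 he).2
    refine FLe.step z W' b hzW ?_ ?_
    · let A : Set V := {a | a ∈ W' \ {z} ∧ ∃ y, y ∉ W' ∧ ∃ M, s(z, y) ::ₘ M ≤ N ∧ CN G M a y}
      have hcut : ∀ c ∈ (W' \ {z}) \ A, ∀ d ∈ (W' \ {z}) \ A, ∀ P ≤ N, CN G P c d →
          ∀ y, y ∉ W' → s(z, y) ∉ P := by
        intro c hc d hd P hP hcd y hy hzy
        obtain ⟨P₁, P₂, rfl, ⟨_, h2⟩ | ⟨h1, _⟩⟩ := hcd.split hzy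
        · exact hd.2 ⟨hd.1, y, hy, P₂,
            (Multiset.cons_le_cons _ (Multiset.le_add_left _ _)).trans hP, h2.symm⟩
        · exact hc.2 ⟨hc.1, y, hy, P₁,
            (Multiset.cons_le_cons _ (Multiset.le_add_right _ _)).trans hP, h1⟩
      have hA : ∀ c ∈ (W' \ {z}) \ A, ∀ d ∈ (W' \ {z}) \ A, ∀ P ≤ N, CN G P c d →
          ∀ p ∈ A, ∀ q, s(p, q) ∉ P := by
        rintro c hc d hd P hP hcd p ⟨_, y, hy, M, hM, hpy⟩ q hpq
        have hzy := hcut c hc d hd P hP hcd y hy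
        obtain ⟨N, rfl⟩ := Multiset.exists_cons_of_mem
          (Multiset.mem_of_le hM (Multiset.mem_cons_self _ _))
        rw [Multiset.cons_le_cons_iff] at hM
        rw [Multiset.le_cons_of_notMem hzy] at hP
        rcases hpy.symm.hit hcd hM hP hpq with ⟨Q, hQ, h⟩ | ⟨Q, hQ, h⟩
        · exact hc.2 ⟨hc.1, y, hy, Q, Multiset.cons_le_cons _ hQ, h.symm⟩
        · exact hd.2 ⟨hd.1, y, hy, Q, Multiset.cons_le_cons _ hQ, h.symm⟩
      refine FLe.of_forall_diff (A := A) (Set.toFinite _) ?_ ?_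
      · rintro a ⟨ha, y, hy, M, hM, hay⟩
        refine restrict _ _ _ ?_ (ih2 _ ?_ _ (hdf _) (hNf _))
        · intro c hc d hd P hP hcd e he
          by_contra hne
          obtain ⟨p, hp, hpW⟩ := hN e (Multiset.mem_of_le hP he)
          obtain ⟨q, rfl⟩ := Sym2.mem_iff_exists.1 hp
          have hno : ¬ (EC G N a c ∨ EC G N a d) := fun h => h.elim hc.2 hd.2
          by_cases hpz : p = z
          · subst hpz
            exact hno (hay.hit_of_cons hcd hM hP he)
          · have : EC G N a p := by
              by_contra h
              exact hne ⟨p, hp, ⟨hpW, hpz⟩, h⟩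
            obtain ⟨Q, hQ, h⟩ := this
            exact hno (h.hit hcd hQ hP he)
        · rintro w ⟨hw, haw⟩
          refine ⟨hW hw.1, fun hzw => haw ?_⟩
          have := hay.concat (CN.base hzw)
          rw [add_zero, Sym2.eq_swap] at this
          exact ⟨_, hM, this⟩
      · refine restrict _ _ _ ?_ (ih1 _ ?_ _ (hdf _) (hNf _))
        · intro c hc d hd' P hP hcd e he
          by_contra hne
          obtain ⟨p, hp, hpW⟩ := hN e (Multiset.mem_of_le hP he)
          obtain ⟨q, rfl⟩ := Sym2.mem_iff_exists.1 hp
          have hmem : ∀ x ∈ s(p, q), x ∈ W' → x ≠ z → x ∈ A := by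
            intro x hx hxW hxz
            by_contra h
            exact hne ⟨x, hx, ⟨hxW, hxz⟩, h⟩
          by_cases hpz : p = z
          · subst hpz
            by_cases hq : q ∈ W'
            · have hqp : q ≠ p := by
                rintro rfl
                exact hd _ (Multiset.mem_of_le hP he) rfl
              refine hA c hc d hd' P hP hcd q (hmem q (Sym2.mem_mk_right _ _) hq hqp) p ?_
              rwa [Sym2.eq_swap]
            · exact hcut c hc d hd' P hP hcd q hq he
          · exact hA c hc d hd' P hP hcd p (hmem p hp hpW hpz) q he
        · rintro w ⟨hw, _⟩
          exact ⟨hW hw.1, hw.2⟩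
    · refine restrict _ _ _ ?_ (ih2 _ ?_ _ (hdf _) (hNf _))
      · intro c hc d hd P hP hcd e he
        by_contra hne
        obtain ⟨p, hp, hpW⟩ := hN e (Multiset.mem_of_le hP he)
        obtain ⟨q, rfl⟩ := Sym2.mem_iff_exists.1 hp
        have : EC G N z p := by
          by_contra h
          exact hne ⟨p, hp, hpW, h⟩
        obtain ⟨Q, hQ, h⟩ := this
        exact (h.hit hcd hQ hP he).elim hc.2 hd.2
      · rintro w ⟨hw, hzw⟩
        exact ⟨hW hw, fun h => hzw (EC.of_adj h)⟩

end EvenConnection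

section Degrees

variable {V : Type}

/-- The exponent of the monomial `x_a x_b` of an edge `s(a, b)`. -/
noncomputable def edgeDeg : Sym2 V → (V →₀ ℕ) :=
  Sym2.lift ⟨fun a b => Finsupp.single a 1 + Finsupp.single b 1, fun _ _ => add_comm _ _⟩

/-- The exponent of the product of the edges in a multiset. -/
noncomputable def mdeg (A : Multiset (Sym2 V)) : V →₀ ℕ := (A.map edgeDeg).sum

@[simp] theorem mdeg_zero : mdeg (0 : Multiset (Sym2 V)) = 0 := by simp [mdeg]

@[simp] theorem mdeg_cons (a b : V) (A : Multiset (Sym2 V)) :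
    mdeg (s(a, b) ::ₘ A) = Finsupp.single a 1 + Finsupp.single b 1 + mdeg A := by
  simp [mdeg, edgeDeg]

theorem mdeg_add (A B : Multiset (Sym2 V)) : mdeg (A + B) = mdeg A + mdeg B := by
  simp [mdeg]

theorem degree_mdeg (A : Multiset (Sym2 V)) : (mdeg A).degree = 2 * A.card := by
  induction A using Multiset.induction_on with
  | empty => simp
  | cons e A ih =>
    induction e using Sym2.ind with
    | _ a b =>
      rw [mdeg_cons, map_add, map_add, ih, Multiset.card_cons]
      simp
      ring

theorem exists_mem_of_mdeg_pos {A : Multiset (Sym2 V)} {p : V} (h : 0 < mdeg A p) :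
    ∃ c, s(p, c) ∈ A := by
  classical
  induction A using Multiset.induction_on with
  | empty => simp at h
  | cons e A ih =>
    induction e using Sym2.ind with
    | _ a b =>
      by_cases ha : p = a
      · exact ⟨b, by rw [ha]; exact Multiset.mem_cons_self _ _⟩
      by_cases hb : p = b
      · exact ⟨a, by rw [hb, Sym2.eq_swap]; exact Multiset.mem_cons_self _ _⟩
      rw [mdeg_cons, Finsupp.add_apply, Finsupp.add_apply, Finsupp.single_eq_of_ne ha,
        Finsupp.single_eq_of_ne hb, zero_add, zero_add] at h
      obtain ⟨c, hc⟩ := ih h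
      exact ⟨c, Multiset.mem_cons_of_mem hc⟩

variable {G : SimpleGraph V}

theorem CN.exists_multiset {M : Multiset (Sym2 V)} {a b : V} (h : CN G M a b) :
    ∃ A : Multiset (Sym2 V), (∀ e ∈ A, e ∈ G.edgeSet) ∧ A.card = M.card + 1 ∧
      mdeg A = mdeg M + (Finsupp.single a 1 + Finsupp.single b 1) := by
  induction h with
  | @base a b h =>
    refine ⟨{s(a, b)}, ?_, by simp, ?_⟩
    · intro e he
      rw [Multiset.mem_singleton.1 he]
      exact h
    · rw [← Multiset.cons_zero, mdeg_cons, add_comm]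
  | @step a b p q M h _ ih =>
    obtain ⟨A, h1, h2, h3⟩ := ih
    refine ⟨s(a, p) ::ₘ A, ?_, by simp [h2], ?_⟩
    · intro e he
      rcases Multiset.mem_cons.1 he with rfl | he
      exacts [h, h1 e he]
    · rw [mdeg_cons, h3, mdeg_cons]
      abel

/-- Starting from a vertex of larger degree in `A` than in `B`, there is an alternating trail
which ends either in a vertex of smaller degree or in a vertex of larger degree. -/
theorem exists_alternating_trail (A : Multiset (Sym2 V)) :
    ∀ (B : Multiset (Sym2 V)) (p : V), (∀ e ∈ A, e ∈ G.edgeSet) → (∀ e ∈ B, e ∈ G.edgeSet) →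
    mdeg B p < mdeg A p →
    (∃ A₁ ≤ A, ∃ B₁ ≤ B, ∃ q, mdeg A q < mdeg B q ∧
      mdeg A₁ + Finsupp.single q 1 = mdeg B₁ + Finsupp.single p 1) ∨
    (∃ M ≤ B, ∃ p', CN G M p p' ∧
      ∀ x, (Finsupp.single p 1 + Finsupp.single p' 1 : V →₀ ℕ) x ≤ mdeg A x - mdeg B x) := by
  classical
  induction A using Multiset.strongInductionOn with
  | ih A ih =>
  intro B p hA hB hp
  obtain ⟨c, hc⟩ := exists_mem_of_mdeg_pos (Nat.zero_lt_of_lt hp)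
  obtain ⟨A, rfl⟩ := Multiset.exists_cons_of_mem hc
  have hpc : G.Adj p c := hA _ hc
  have hA' : ∀ e ∈ A, e ∈ G.edgeSet := fun e he => hA e (Multiset.mem_cons_of_mem he)
  by_cases hcx : mdeg B c < mdeg (s(p, c) ::ₘ A) c
  · refine Or.inr ⟨0, Multiset.zero_le _, c, CN.base hpc, fun x => ?_⟩
    have hne := hpc.ne
    rw [Finsupp.add_apply, Finsupp.single_apply, Finsupp.single_apply]
    split_ifs with h1 h2 h2
    · exact absurd (h1.trans h2.symm) hne
    · subst h1; omega
    · subst h2; omega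
    · omega
  have hcA : 0 < mdeg (s(p, c) ::ₘ A) c := by simp
  obtain ⟨d, hd⟩ := exists_mem_of_mdeg_pos (hcA.trans_le (not_lt.1 hcx))
  obtain ⟨B, rfl⟩ := Multiset.exists_cons_of_mem hd
  have hcd : G.Adj c d := hB _ hd
  have hB' : ∀ e ∈ B, e ∈ G.edgeSet := fun e he => hB e (Multiset.mem_cons_of_mem he)
  have hdA : ∀ x, mdeg (s(p, c) ::ₘ A) x =
      (if p = x then 1 else 0) + (if c = x then 1 else 0) + mdeg A x := by
    intro x
    simp only [mdeg_cons, Finsupp.add_apply, Finsupp.single_apply]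
  have hdB : ∀ x, mdeg (s(c, d) ::ₘ B) x =
      (if c = x then 1 else 0) + (if d = x then 1 else 0) + mdeg B x := by
    intro x
    simp only [mdeg_cons, Finsupp.add_apply, Finsupp.single_apply]
  have hlt : A < s(p, c) ::ₘ A := Multiset.lt_cons_self _ _
  by_cases hdp : d = p
  · subst hdp
    have hp' : mdeg B d < mdeg A d := by
      rw [hdA, hdB] at hp
      omega
    rcases ih A hlt B d hA' hB' hp' with ⟨A₁, hA₁, B₁, hB₁, q, hq, heq⟩ | ⟨M, hM, p', hcn, hx⟩
    · refine Or.inl ⟨A₁, hA₁.trans (Multiset.le_cons_self _ _), B₁,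
        hB₁.trans (Multiset.le_cons_self _ _), q, ?_, heq⟩
      rw [hdA, hdB]
      omega
    · refine Or.inr ⟨M, hM.trans (Multiset.le_cons_self _ _), p', hcn, fun x => ?_⟩
      have := hx x
      rw [hdA, hdB]
      omega
  by_cases hdd : mdeg (s(p, c) ::ₘ A) d < mdeg (s(c, d) ::ₘ B) d
  · refine Or.inl ⟨{s(p, c)}, by simp, {s(c, d)}, by simp, d, hdd, ?_⟩
    rw [← Multiset.cons_zero, ← Multiset.cons_zero, mdeg_cons, mdeg_cons]
    abel
  have hp' : mdeg B d < mdeg A d := by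
    rw [hdA, hdB] at hdd
    have h1 : ¬ p = d := fun h => hdp h.symm
    simp only [if_true, if_neg h1] at hdd
    omega
  rcases ih A hlt B d hA' hB' hp' with ⟨A₁, hA₁, B₁, hB₁, q, hq, heq⟩ | ⟨M, hM, p', hcn, hx⟩
  · refine Or.inl ⟨_, Multiset.cons_le_cons _ hA₁, _, Multiset.cons_le_cons _ hB₁, q, ?_, ?_⟩
    · rw [hdA, hdB] at hp ⊢
      have hqd : d ≠ q := by rintro rfl; omega
      have hqp : p ≠ q := by
        rintro rfl
        rw [if_neg hdp, if_pos rfl] at hp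
        omega
      rw [if_neg hqd, if_neg hqp]
      omega
    · rw [mdeg_cons, mdeg_cons, add_assoc, heq]
      abel
  · refine Or.inr ⟨_, Multiset.cons_le_cons _ hM, p', CN.step hpc hcn, fun x => ?_⟩
    have := hx x
    have h2 := hdA x
    have h3 := hdB x
    simp only [Finsupp.add_apply, Finsupp.single_apply] at this ⊢
    by_cases hxp : p = x
    · subst hxp
      rw [if_neg hdp] at this h3
      rw [if_pos rfl] at h2 ⊢
      omega
    · by_cases hxd : d = x
      · subst hxd
        rw [if_pos rfl] at this h3
        rw [if_neg hxp] at h2 ⊢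
        omega
      · rw [if_neg hxd] at this h3
        rw [if_neg hxp] at h2 ⊢
        omega

theorem exists_exchange {Γ : Type} [AddCommMonoid Γ] [LinearOrder Γ]
    [IsOrderedCancelAddMonoid Γ] (κ : Multiset (Sym2 V) →+ Γ) (A : Multiset (Sym2 V)) :
    ∀ B : Multiset (Sym2 V), (∀ e ∈ A, e ∈ G.edgeSet) → (∀ e ∈ B, e ∈ G.edgeSet) →
    (A.card = B.card + 1 ∨ (A.card = B.card ∧ κ B < κ A)) →
    (∃ M ≤ B, ∃ p p', CN G M p p' ∧
      ∀ x, (Finsupp.single p 1 + Finsupp.single p' 1 : V →₀ ℕ) x ≤ mdeg A x - mdeg B x) ∨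
    (∃ A₁ ≤ A, ∃ B₁ ≤ B, A₁.card = B₁.card ∧ κ B₁ < κ A₁ ∧
      (mdeg A₁ = mdeg B₁ ∨ ∃ p q, mdeg B p < mdeg A p ∧
        mdeg A₁ + Finsupp.single q 1 = mdeg B₁ + Finsupp.single p 1)) := by
  classical
  induction A using Multiset.strongInductionOn with
  | ih A ih =>
  intro B hA hB hAB
  by_cases hdeg : mdeg A = mdeg B
  · have hcard := congrArg Finsupp.degree hdeg
    rw [degree_mdeg, degree_mdeg] at hcard
    rcases hAB with h | ⟨h, hκ⟩
    · omega
    · exact Or.inr ⟨A, le_rfl, B, le_rfl, h, hκ, Or.inl hdeg⟩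
  have hex : ∃ p, mdeg B p < mdeg A p := by
    by_contra! hle
    have hle' : mdeg A ≤ mdeg B := hle
    obtain ⟨C, hC⟩ := exists_add_of_le hle'
    have hcard := congrArg Finsupp.degree hC
    rw [map_add, degree_mdeg, degree_mdeg] at hcard
    have h0 : C.degree = 0 := by omega
    rw [Finsupp.degree_eq_zero_iff] at h0
    rw [h0, add_zero] at hC
    exact hdeg hC.symm
  obtain ⟨p, hp⟩ := hex
  rcases exists_alternating_trail A B p hA hB hp with
    ⟨A₁, hA₁, B₁, hB₁, q, hq, heq⟩ | ⟨M, hM, p', hcn, hx⟩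
  swap
  · exact Or.inl ⟨M, hM, p, p', hcn, hx⟩
  have hcard₁ : A₁.card = B₁.card := by
    have := congrArg Finsupp.degree heq
    simp only [map_add, degree_mdeg, Finsupp.degree_single] at this
    omega
  by_cases hκ : κ B₁ < κ A₁
  · exact Or.inr ⟨A₁, hA₁, B₁, hB₁, hcard₁, hκ, Or.inr ⟨p, q, hp, heq⟩⟩
  obtain ⟨A₂, rfl⟩ := Multiset.le_iff_exists_add.1 hA₁
  obtain ⟨B₂, rfl⟩ := Multiset.le_iff_exists_add.1 hB₁
  have hpq : p ≠ q := by
    rintro rfl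
    omega
  have hne : A₁ ≠ 0 := by
    rintro rfl
    have h0 : B₁ = 0 := Multiset.card_eq_zero.1 hcard₁.symm
    rw [h0, add_left_cancel_iff] at heq
    exact hpq (Finsupp.single_left_injective one_ne_zero heq).symm
  have hlt : A₂ < A₁ + A₂ := by
    refine lt_of_le_of_ne (Multiset.le_add_left _ _) fun h => hne ?_
    have := congrArg Multiset.card h
    rw [Multiset.card_add] at this
    exact Multiset.card_eq_zero.1 (by omega)
  have hpt : ∀ x, mdeg A₁ x + (if q = x then 1 else 0) = mdeg B₁ x + (if p = x then 1 else 0) := by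
    intro x
    have := DFunLike.congr_fun heq x
    simpa only [Finsupp.add_apply, Finsupp.single_apply] using this
  have hsub : ∀ x, mdeg A₂ x - mdeg B₂ x ≤ mdeg (A₁ + A₂) x - mdeg (B₁ + B₂) x := by
    intro x
    have h := hpt x
    rw [mdeg_add, mdeg_add, Finsupp.add_apply, Finsupp.add_apply] at hq ⊢
    by_cases hqx : q = x
    · subst hqx
      rw [if_pos rfl, if_neg hpq] at h
      omega
    · rw [if_neg hqx] at h
      split_ifs at h <;> omega
  have hAB₂ : A₂.card = B₂.card + 1 ∨ (A₂.card = B₂.card ∧ κ B₂ < κ A₂) := by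
    rw [Multiset.card_add, Multiset.card_add, map_add, map_add] at hAB
    refine hAB.imp (fun h => by omega) fun h => ⟨by omega, ?_⟩
    by_contra hle
    exact absurd h.2 (not_lt.2 (add_le_add (not_lt.1 hκ) (not_lt.1 hle)))
  rcases ih A₂ hlt B₂ (fun e he => hA e (Multiset.mem_add.2 (Or.inr he)))
    (fun e he => hB e (Multiset.mem_add.2 (Or.inr he))) hAB₂ with
    ⟨M, hM, p₀, p', hcn, hx⟩ | ⟨A₃, hA₃, B₃, hB₃, hc, hκ₃, h3⟩
  · exact Or.inl ⟨M, hM.trans (Multiset.le_add_left _ _), p₀, p', hcn,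
      fun x => (hx x).trans (hsub x)⟩
  · refine Or.inr ⟨A₃, hA₃.trans (Multiset.le_add_left _ _), B₃,
      hB₃.trans (Multiset.le_add_left _ _), hc, hκ₃, h3.imp id ?_⟩
    rintro ⟨p₀, q₀, h, h'⟩
    refine ⟨p₀, q₀, ?_, h'⟩
    have := hsub p₀
    omega

end Degrees

section Powers

variable {V : Type}

/-- The multisets of `s` edges of `G`. -/
def edgeMs (G : SimpleGraph V) (s : ℕ) : Set (Multiset (Sym2 V)) :=
  {A | A.card = s ∧ ∀ e ∈ A, e ∈ G.edgeSet}

/-- The exponents divisible by a product of `s` edges. -/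
def powU (G : SimpleGraph V) (s : ℕ) : Set (V →₀ ℕ) := {n | ∃ A ∈ edgeMs G s, mdeg A ≤ n}

theorem isUpperSet_powU (G : SimpleGraph V) (s : ℕ) : IsUpperSet (powU G s) := by
  rintro m n hmn ⟨A, hA, h⟩
  exact ⟨A, hA, h.trans hmn⟩

theorem edgeIdeal_pow (K : Type) [Field K] (G : SimpleGraph V) (s : ℕ) :
    edgeIdeal K G ^ s = monoIdeal K (mdeg '' edgeMs G s) := by
  induction s with
  | zero =>
    rw [pow_zero, Ideal.one_eq_top, eq_comm, Ideal.eq_top_iff_one]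
    exact Ideal.subset_span ⟨0, ⟨0, ⟨by simp, by simp⟩, mdeg_zero⟩, rfl⟩
  | succ s ih =>
    rw [pow_succ, ih, monoIdeal, edgeIdeal, Ideal.span_mul_span', monoIdeal]
    congr 1
    ext p
    constructor
    · rintro ⟨_, ⟨_, ⟨A, hA, rfl⟩, rfl⟩, _, ⟨u, v, huv, rfl⟩, rfl⟩
      refine ⟨_, ⟨s(u, v) ::ₘ A, ⟨by simp [hA.1], ?_⟩, rfl⟩, ?_⟩
      · intro e he
        rcases Multiset.mem_cons.1 he with rfl | he
        exacts [huv, hA.2 e he]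
      · simp only [mdeg_cons, MvPolynomial.X, MvPolynomial.monomial_mul, mul_one]
        rw [add_comm]
    · rintro ⟨_, ⟨A, hA, rfl⟩, rfl⟩
      have hne : A ≠ 0 := by
        rintro rfl
        exact absurd hA.1 (by simp)
      obtain ⟨e, he⟩ := Multiset.exists_mem_of_ne_zero hne
      obtain ⟨A, rfl⟩ := Multiset.exists_cons_of_mem he
      induction e using Sym2.ind with
      | _ u v =>
        refine ⟨_, ⟨_, ⟨A, ⟨by simpa using hA.1, fun e h => hA.2 e (Multiset.mem_cons_of_mem h)⟩,
          rfl⟩, rfl⟩, _, ⟨u, v, hA.2 _ (Multiset.mem_cons_self _ _), rfl⟩, ?_⟩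
        simp only [mdeg_cons, MvPolynomial.X, MvPolynomial.monomial_mul, mul_one]
        rw [add_comm]

theorem edgeIdeal_pow_eq_powU (K : Type) [Field K] (G : SimpleGraph V) (s : ℕ) :
    edgeIdeal K G ^ s = monoIdeal K (powU G s) := by
  rw [edgeIdeal_pow]
  ext p
  rw [mem_monoIdeal (isUpperSet_powU G s), monoIdeal, MvPolynomial.mem_ideal_span_monomial_image]
  refine forall₂_congr fun m _ => ?_
  constructor
  · rintro ⟨_, ⟨A, hA, rfl⟩, h⟩
    exact ⟨A, hA, h⟩
  · rintro ⟨A, hA, h⟩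
    exact ⟨_, ⟨A, hA, rfl⟩, h⟩

theorem finite_edgeMs [Finite V] (G : SimpleGraph V) (s : ℕ) : (edgeMs G s).Finite := by
  classical
  have := Fintype.ofFinite V
  refine (Set.finite_range (fun x : Sym (Sym2 V) s => x.1)).subset ?_
  rintro A ⟨hA, _⟩
  exact ⟨⟨A, hA⟩, rfl⟩

theorem powU_one (G : SimpleGraph V) : powU G 1 = edgeSetU G.Adj Set.univ := by
  ext n
  constructor
  · rintro ⟨A, ⟨hA, hAG⟩, hn⟩
    obtain ⟨e, rfl⟩ := Multiset.card_eq_one.1 hA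
    induction e using Sym2.ind with
    | _ u v =>
      refine Or.inr ⟨u, v, hAG _ (Multiset.mem_singleton_self _), ?_⟩
      rwa [← Multiset.cons_zero, mdeg_cons, mdeg_zero, add_zero] at hn
  · rintro (⟨x, hx, _⟩ | ⟨u, v, huv, hn⟩)
    · exact absurd (Set.mem_univ x) hx
    · refine ⟨{s(u, v)}, ⟨by simp, ?_⟩, ?_⟩
      · intro e he
        rw [Multiset.mem_singleton.1 he]
        exact huv
      · rwa [← Multiset.cons_zero, mdeg_cons, mdeg_zero, add_zero]

theorem powU_succ_subset (G : SimpleGraph V) (s : ℕ) : powU G (s + 1) ⊆ powU G s := by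
  rintro n ⟨A, ⟨hA, hAG⟩, hn⟩
  have hne : A ≠ 0 := by
    rintro rfl
    simp at hA
  obtain ⟨e, he⟩ := Multiset.exists_mem_of_ne_zero hne
  obtain ⟨A, rfl⟩ := Multiset.exists_cons_of_mem he
  refine ⟨A, ⟨by simpa using hA, fun e h => hAG e (Multiset.mem_cons_of_mem h)⟩, le_trans ?_ hn⟩
  rw [← Multiset.singleton_add, mdeg_add]
  exact le_add_self

/-- The exponents divisible by a product of `s + 1` edges or by one of the members of `T`. -/
def stageU (G : SimpleGraph V) (s : ℕ) (T : Set (Multiset (Sym2 V))) : Set (V →₀ ℕ) :=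
  powU G (s + 1) ∪ {n | ∃ A ∈ T, mdeg A ≤ n}

theorem isUpperSet_stageU (G : SimpleGraph V) (s : ℕ) (T : Set (Multiset (Sym2 V))) :
    IsUpperSet (stageU G s T) := by
  refine (isUpperSet_powU G (s + 1)).union ?_
  rintro m n hmn ⟨A, hA, h⟩
  exact ⟨A, hA, h.trans hmn⟩

variable {Γ : Type} [AddCommMonoid Γ] [LinearOrder Γ] [IsOrderedCancelAddMonoid Γ]

theorem colonSet_stageU (κ : Multiset (Sym2 V) →+ Γ) {G : SimpleGraph V} {s : ℕ}
    {B : Multiset (Sym2 V)} (hB : B ∈ edgeMs G s)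
    (hmax : ∀ A ∈ edgeMs G s, κ B < κ A → mdeg A ≠ mdeg B) :
    colonSet (stageU G s {A | A ∈ edgeMs G s ∧ κ B < κ A}) (mdeg B) =
      edgeSetU (EC G B) {p | ¬ ∃ A ∈ edgeMs G s, κ B < κ A ∧
        mdeg A ≤ Finsupp.single p 1 + mdeg B} := by
  classical
  have key : ∀ (n : V →₀ ℕ) (A : Multiset (Sym2 V)), (∀ e ∈ A, e ∈ G.edgeSet) →
      (A.card = B.card + 1 ∨ (A.card = B.card ∧ κ B < κ A)) → mdeg A ≤ n + mdeg B →
      n ∈ edgeSetU (EC G B) {p | ¬ ∃ A ∈ edgeMs G s, κ B < κ A ∧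
        mdeg A ≤ Finsupp.single p 1 + mdeg B} := by
    intro n A hA hAB hn
    rcases exists_exchange κ A B hA hB.2 hAB with
      ⟨M, hM, p, p', hcn, hx⟩ | ⟨A₁, hA₁, B₁, hB₁, hcard, hκ, h⟩
    · refine Or.inr ⟨p, p', ⟨M, hM, hcn⟩, fun x => (hx x).trans ?_⟩
      have := hn x
      rw [Finsupp.add_apply] at this
      omega
    · obtain ⟨B₂, rfl⟩ := Multiset.le_iff_exists_add.1 hB₁
      have hmem : A₁ + B₂ ∈ edgeMs G s := by
        refine ⟨by rw [Multiset.card_add, hcard, ← Multiset.card_add, hB.1], fun e he => ?_⟩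
        rcases Multiset.mem_add.1 he with h | h
        · exact hA e (Multiset.mem_of_le hA₁ h)
        · exact hB.2 e (Multiset.mem_add.2 (Or.inr h))
      have hlt : κ (B₁ + B₂) < κ (A₁ + B₂) := by
        rw [map_add, map_add]
        exact add_lt_add_left hκ _
      rcases h with h | ⟨p, q, hpq, h⟩
      · exact absurd (by rw [mdeg_add, mdeg_add, h]) (hmax _ hmem hlt)
      · refine Or.inl ⟨p, fun hp => hp ⟨_, hmem, hlt, ?_⟩, ?_⟩
        · rw [mdeg_add, mdeg_add, ← add_assoc, add_comm (Finsupp.single p 1), ← h]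
          exact add_le_add (le_self_add) le_rfl
        · have := hn p
          rw [Finsupp.add_apply] at this
          omega
  ext n
  constructor
  · rintro (⟨A, hA, hn⟩ | ⟨A, ⟨hA, hκ⟩, hn⟩)
    · exact key n A hA.2 (Or.inl (by rw [hA.1, hB.1])) hn
    · exact key n A hA.2 (Or.inr ⟨by rw [hA.1, hB.1], hκ⟩) hn
  · rintro (⟨p, hp, hn⟩ | ⟨p, q, ⟨M, hM, hcn⟩, hn⟩)
    · obtain ⟨A, hA, hκ, hle⟩ := not_not.1 hp
      refine Or.inr ⟨A, ⟨hA, hκ⟩, hle.trans ?_⟩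
      exact add_le_add (single_le_iff_one_le.2 hn) le_rfl
    · obtain ⟨A, hA, hcard, hdeg⟩ := hcn.exists_multiset
      obtain ⟨C, rfl⟩ := Multiset.le_iff_exists_add.1 hM
      refine Or.inl ⟨A + C, ⟨?_, fun e he => ?_⟩, ?_⟩
      · have := hB.1
        rw [Multiset.card_add] at this ⊢
        omega
      · rcases Multiset.mem_add.1 he with h | h
        · exact hA e h
        · exact hB.2 e (Multiset.mem_add.2 (Or.inr h))
      · rw [mdeg_add, mdeg_add, hdeg, add_comm (mdeg M), add_assoc]
        exact add_le_add hn le_rfl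

theorem regU_stageU {K : Type} [Field K] [Finite V] (κ : Multiset (Sym2 V) →+ Γ)
    (hκ : Function.Injective κ) {G : SimpleGraph V} {s r b : ℕ}
    (hG : FLe G.Adj Set.univ b) (hpow : RegU K (powU G s) r) (hr : b + 1 + 2 * s ≤ r) :
    ∀ (n : ℕ) (T : Set (Multiset (Sym2 V))), T ⊆ edgeMs G s →
      (∀ A ∈ T, ∀ B ∈ edgeMs G s, κ A < κ B → B ∈ T) → (edgeMs G s \ T).ncard = n →
      RegU K (stageU G s T) r := by
  intro n
  induction n with
  | zero =>
    intro T hT _ hn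
    rw [Set.ncard_eq_zero ((finite_edgeMs G s).subset Set.sdiff_subset), Set.sdiff_eq_empty] at hn
    have : stageU G s T = powU G s := by
      rw [hT.antisymm hn]
      exact Set.union_eq_right.2 (powU_succ_subset G s)
    rwa [this]
  | succ n ih =>
    intro T hT hup hn
    have hfin : (edgeMs G s \ T).Finite := (finite_edgeMs G s).subset Set.sdiff_subset
    have hne : (edgeMs G s \ T).Nonempty := by
      rw [← Set.ncard_pos hfin]
      omega
    obtain ⟨B, ⟨hB, hBT⟩, hmax⟩ := hfin.exists_maximalFor κ _ hne
    have hTeq : T = {A | A ∈ edgeMs G s ∧ κ B < κ A} := by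
      ext A
      constructor
      · intro hA
        refine ⟨hT hA, ?_⟩
        by_contra hle
        rcases (not_lt.1 hle).lt_or_eq with h | h
        · exact hBT (hup A hA B hB h)
        · exact hBT (hκ h ▸ hA)
      · rintro ⟨hA, hlt⟩
        by_contra hAT
        exact absurd (hmax ⟨hA, hAT⟩ hlt.le) (not_le.2 hlt)
    have hnext : RegU K (stageU G s (insert B T)) r := by
      refine ih (insert B T) (Set.insert_subset hB hT) ?_ ?_
      · rintro A (rfl | hA) C hC hlt
        · refine Or.inr ?_
          rw [hTeq]
          exact ⟨hC, hlt⟩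
        · exact Or.inr (hup A hA C hC hlt)
      · have : edgeMs G s \ insert B T = (edgeMs G s \ T) \ {B} := by
          ext A
          simp only [Set.mem_sdiff, Set.mem_insert_iff, Set.mem_singleton_iff]
          tauto
        rw [this, Set.ncard_sdiff_singleton_of_mem (show B ∈ edgeMs G s \ T from ⟨hB, hBT⟩),
          hn, Nat.add_sub_cancel]
    have hstage : stageU G s (insert B T) = stageU G s T ∪ Set.Ici (mdeg B) := by
      ext m
      constructor
      · rintro (h | ⟨A, rfl | hA, h⟩)
        exacts [Or.inl (Or.inl h), Or.inr h, Or.inl (Or.inr ⟨A, hA, h⟩)]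
      · rintro ((h | ⟨A, hA, h⟩) | h)
        exacts [Or.inl h, Or.inr ⟨A, Or.inr hA, h⟩, Or.inr ⟨B, Or.inl rfl, h⟩]
    rw [hstage] at hnext
    by_cases hex : ∃ A ∈ edgeMs G s, κ B < κ A ∧ mdeg A = mdeg B
    · obtain ⟨A, hA, hlt, hdeg⟩ := hex
      rwa [Set.union_eq_left.2] at hnext
      intro m hm
      exact Or.inr ⟨A, by rw [hTeq]; exact ⟨hA, hlt⟩, hdeg ▸ hm⟩
    · refine RegU.of_colon (isUpperSet_stageU G s T) (mdeg B) (r₀ := b + 1) ?_ hnext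
        (by rw [degree_mdeg, hB.1]; exact hr)
      rw [hTeq, colonSet_stageU κ hB fun A hA hlt hdeg => hex ⟨A, hA, hlt, hdeg⟩]
      refine FLe.regU (fun _ _ => EC.symm) (FLe.subset ?_ (Set.subset_univ _))
      refine hG.evenConnection _ subset_rfl B (fun e he => ?_) fun e _ => ?_
      · exact G.not_isDiag_of_mem_edgeSet (hB.2 e he)
      · exact ⟨e.out.1, e.out_fst_mem, Set.mem_univ _⟩

theorem exists_injective_key (α : Type) [Finite α] :
    ∃ (Γ : Type) (_ : AddCommMonoid Γ) (_ : LinearOrder Γ) (_ : IsOrderedCancelAddMonoid Γ)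
      (κ : Multiset α →+ Γ), Function.Injective κ := by
  classical
  obtain ⟨n, ⟨e⟩⟩ := Finite.exists_equiv_fin α
  let L : MonomialOrder (Fin n) := MonomialOrder.lex
  refine ⟨L.syn, inferInstance, inferInstance, inferInstance,
    L.toSyn.toAddMonoidHom.comp (Multiset.toFinsupp.toAddMonoidHom.comp
      (Multiset.mapAddMonoidHom e)), ?_⟩
  exact L.toSyn.injective.comp
    (Multiset.toFinsupp.injective.comp (Multiset.map_injective e.injective))

theorem FLe.regU_powU {K : Type} [Field K] [Finite V] {G : SimpleGraph V} {b : ℕ}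
    (hG : FLe G.Adj Set.univ b) (s : ℕ) : RegU K (powU G (s + 1)) (2 * (s + 1) + b - 1) := by
  induction s with
  | zero =>
    rw [zero_add, powU_one]
    exact (hG.regU fun _ _ h => h.symm).mono (by omega)
  | succ s ih =>
    obtain ⟨Γ, _, _, _, κ, hκ⟩ := exists_injective_key (Sym2 V)
    have := regU_stageU (K := K) (r := 2 * (s + 1 + 1) + b - 1) κ hκ hG
      (ih.mono (by omega)) (by omega) _ ∅ (Set.empty_subset _) (fun A hA => absurd hA (by simp)) rfl
    simpa [stageU] using this

end Powers

section Blobs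

variable {V : Type} {G : SimpleGraph V}

/-- Every edge of `G` inside `W` meets `T`. -/
def CoversIn (G : SimpleGraph V) (W T : Set V) : Prop :=
  ∀ u ∈ W, ∀ v ∈ W, G.Adj u v → u ∈ T ∨ v ∈ T

/-- The bound `c` holds for all vertex sets whose edges are covered by `T`. -/
def CoverBound (G : SimpleGraph V) (c : ℕ) (T : Set V) : Prop :=
  ∀ W, CoversIn G W T → FLe G.Adj W c

theorem CoversIn.of_insert {W W' T : Set V} {x : V} (h : CoversIn G W (insert x T))
    (hW : W' ⊆ W) (hx : ∀ u ∈ W', G.Adj x u → x ∉ W') : CoversIn G W' T := by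
  intro u hu v hv huv
  have hux : u ≠ x := by
    rintro rfl
    exact hx v hv huv hu
  have hvx : v ≠ x := by
    rintro rfl
    exact hx u hu huv.symm hv
  exact (h u (hW hu) v (hW hv) huv).imp (fun h => h.resolve_left hux) fun h => h.resolve_left hvx

theorem CoversIn.sdiff_singleton {W T : Set V} {x : V} (h : CoversIn G W (insert x T)) :
    CoversIn G (W \ {x}) T :=
  h.of_insert Set.sdiff_subset fun _ _ _ hx => hx.2 rfl

theorem CoversIn.sdiff_neighbors {W T : Set V} {x : V} (h : CoversIn G W (insert x T)) :
    CoversIn G (W \ {w | G.Adj x w}) T :=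
  h.of_insert Set.sdiff_subset fun _ hu hadj => absurd hadj hu.2

theorem CoversIn.remove {W T : Set V} {x : V} (h : CoversIn G W (insert x T)) (hx : x ∉ W) :
    CoversIn G W T :=
  h.of_insert subset_rfl fun _ _ _ => hx

theorem coverBound_empty (G : SimpleGraph V) : CoverBound G 0 ∅ := fun W hW =>
  FLe.edgeless W 0 fun u hu v hv huv => (hW u hu v hv huv).elim id id

theorem CoverBound.insert_one {c : ℕ} {T : Set V} (h : CoverBound G c T) (y : V) :
    CoverBound G (c + 1) (insert y T) := by
  intro W hW
  by_cases hy : y ∈ W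
  · exact FLe.step y W c hy (h _ hW.sdiff_singleton).succ (h _ hW.sdiff_neighbors)
  · exact (h _ (hW.remove hy)).succ

theorem CoverBound.insert_pair {c : ℕ} {T : Set V} (h : CoverBound G c T) {x y : V}
    (hxy : G.Adj x y) : CoverBound G (c + 1) (insert x (insert y T)) := by
  intro W hW
  by_cases hx : x ∈ W
  · refine FLe.step x W c hx (h.insert_one y _ hW.sdiff_singleton) (h _ ?_)
    exact hW.sdiff_neighbors.remove fun hy => hy.2 hxy
  · exact h.insert_one y _ (hW.remove hx)

theorem CoverBound.insert_cycle {c : ℕ} {T : Set V} (h : CoverBound G c T) {v : ZMod 5 → V}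
    (hv : ∀ i, G.Adj (v i) (v (i + 1))) :
    CoverBound G (c + 2) (insert (v 0) (insert (v 1) (insert (v 2) (insert (v 3)
      (insert (v 4) T))))) := by
  have h34 := h.insert_pair (hv 3)
  have h12 := h34.insert_pair (hv 1)
  have h23 := h.insert_pair (hv 2)
  intro W hW
  by_cases h0 : v 0 ∈ W
  · refine FLe.step (v 0) W (c + 1) h0 (h12 _ hW.sdiff_singleton) (h23 _ ?_)
    have hW1 := hW.sdiff_neighbors.remove fun h1 => h1.2 (hv 0)
    rw [Set.insert_comm (v 3), Set.insert_comm (v 2)] at hW1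
    exact hW1.remove fun h4 => h4.2 (hv 4).symm
  · exact h12 _ (hW.remove h0)

/-- There is a matching with `c` edges inside the vertex set `T`. -/
def HasMatchingIn {U : Type} (F : SimpleGraph U) (c : ℕ) (T : Set U) : Prop :=
  ∃ M : F.Subgraph, M.IsMatching ∧ M.verts ⊆ T ∧ M.edgeSet.ncard = c

theorem hasMatchingIn_empty {U : Type} (F : SimpleGraph U) : HasMatchingIn F 0 ∅ :=
  ⟨⊥, by intro v hv; exact absurd hv (by simp), by simp, by simp⟩

theorem HasMatchingIn.mono {U : Type} {F : SimpleGraph U} {c : ℕ} {T T' : Set U}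
    (h : HasMatchingIn F c T) (hT : T ⊆ T') : HasMatchingIn F c T' := by
  obtain ⟨M, h1, h2, h3⟩ := h
  exact ⟨M, h1, h2.trans hT, h3⟩

theorem HasMatchingIn.insert_pair {U : Type} [Finite U] {F : SimpleGraph U} {c : ℕ} {T : Set U}
    (h : HasMatchingIn F c T) {x y : U} (hxy : F.Adj x y) (hx : x ∉ T) (hy : y ∉ T) :
    HasMatchingIn F (c + 1) (insert x (insert y T)) := by
  obtain ⟨M, h1, h2, h3⟩ := h
  refine ⟨M ⊔ F.subgraphOfAdj hxy, h1.sup (Subgraph.IsMatching.subgraphOfAdj hxy) ?_, ?_, ?_⟩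
  · rw [support_subgraphOfAdj, Set.disjoint_right]
    intro z hz hzM
    have hzT := h2 (M.support_subset_verts hzM)
    rcases hz with rfl | rfl
    exacts [hx hzT, hy hzT]
  · rw [Subgraph.verts_sup]
    refine Set.union_subset (h2.trans ?_) ?_
    · exact (Set.subset_insert _ _).trans (Set.subset_insert _ _)
    · rw [subgraphOfAdj_verts]
      rintro z (rfl | rfl)
      exacts [Or.inl rfl, Or.inr (Or.inl rfl)]
  · rw [Subgraph.edgeSet_sup, edgeSet_subgraphOfAdj, Set.union_singleton,
      Set.ncard_insert_of_notMem _ (Set.toFinite _), h3]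
    intro hmem
    exact hx (h2 (M.edge_vert hmem))

theorem exists_of_iso_k2 {U : Type} {F : SimpleGraph U} {T : Set U}
    (e : F.induce T ≃g k2) : ∃ x y, F.Adj x y ∧ T = {x, y} := by
  refine ⟨e.symm 0, e.symm 1, ?_, ?_⟩
  · have : (F.induce T).Adj (e.symm 0) (e.symm 1) :=
      e.symm.map_rel_iff.2 (by simp [k2])
    exact this
  · ext z
    constructor
    · intro hz
      have h1 : e.symm (e ⟨z, hz⟩) = ⟨z, hz⟩ := e.symm_apply_apply _
      have h2 : e ⟨z, hz⟩ = 0 ∨ e ⟨z, hz⟩ = 1 := by omega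
      rcases h2 with h2 | h2
      · rw [h2] at h1
        exact Or.inl (congrArg Subtype.val h1).symm
      · rw [h2] at h1
        exact Or.inr (congrArg Subtype.val h1).symm
    · rintro (rfl | rfl)
      exacts [(e.symm 0).2, (e.symm 1).2]

theorem exists_of_iso_cycle5 {U : Type} {F : SimpleGraph U} {T : Set U}
    (e : F.induce T ≃g cycle5) : ∃ v : ZMod 5 → U, Function.Injective v ∧
      (∀ i, F.Adj (v i) (v (i + 1))) ∧ T = {v 0, v 1, v 2, v 3, v 4} := by
  refine ⟨fun i => e.symm i, fun i j hij => e.symm.injective (Subtype.ext hij), ?_, ?_⟩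
  · intro i
    have : (F.induce T).Adj (e.symm i) (e.symm (i + 1)) := by
      refine e.symm.map_rel_iff.2 ?_
      rw [cycle5, SimpleGraph.fromRel_adj]
      exact ⟨(by decide : ∀ i : ZMod 5, i ≠ i + 1) i, Or.inl rfl⟩
    exact this
  · ext z
    constructor
    · intro hz
      have h1 : (e.symm (e ⟨z, hz⟩)).1 = z := congrArg Subtype.val (e.symm_apply_apply _)
      have h2 : ∀ i : ZMod 5, i = 0 ∨ i = 1 ∨ i = 2 ∨ i = 3 ∨ i = 4 := by decide
      rcases h2 (e ⟨z, hz⟩) with h | h | h | h | h <;> rw [h] at h1 <;> simp [← h1]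
    · rintro (rfl | rfl | rfl | rfl | rfl)
      exacts [(e.symm 0).2, (e.symm 1).2, (e.symm 2).2, (e.symm 3).2, (e.symm 4).2]

theorem exists_coverBound_hasMatchingIn [Finite V] {H : G.Subgraph} (hH : IsK2C5Graph H.coe)
    (S : Set H.coe.ConnectedComponent) :
    ∃ c, CoverBound G c (Subtype.val '' {v | H.coe.connectedComponentMk v ∈ S}) ∧
      HasMatchingIn H.coe c {v | H.coe.connectedComponentMk v ∈ S} := by
  classical
  have hadj : ∀ {x y : H.verts}, H.coe.Adj x y → G.Adj x y := fun h => H.adj_sub h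
  induction S, Set.toFinite S using Set.Finite.induction_on with
  | empty =>
    refine ⟨0, ?_, ?_⟩
    · simpa using coverBound_empty G
    · simpa using hasMatchingIn_empty H.coe
  | @insert C S hC _ ih =>
    obtain ⟨c, h1, h2⟩ := ih
    have hset : {v | H.coe.connectedComponentMk v ∈ insert C S} =
        C.supp ∪ {v | H.coe.connectedComponentMk v ∈ S} := by
      ext v
      rfl
    have hout : ∀ x ∈ C.supp, x ∉ {v | H.coe.connectedComponentMk v ∈ S} := by
      intro x hx hxS
      have : H.coe.connectedComponentMk x = C := hx
      exact hC (this ▸ hxS)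
    rw [hset, Set.image_union]
    rcases hH C with ⟨⟨e⟩⟩ | ⟨⟨e⟩⟩
    · obtain ⟨x, y, hxy, hsupp⟩ := exists_of_iso_k2 e
      rw [hsupp] at hout ⊢
      refine ⟨c + 1, ?_, ?_⟩
      · simpa [Set.image_insert_eq, Set.insert_union] using h1.insert_pair (hadj hxy)
      · rw [Set.insert_union, Set.singleton_union]
        exact h2.insert_pair hxy (hout x (by simp)) (hout y (by simp))
    · obtain ⟨v, hinj, hv, hsupp⟩ := exists_of_iso_cycle5 e
      rw [hsupp] at hout ⊢
      refine ⟨c + 2, ?_, ?_⟩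
      · simpa [Set.image_insert_eq, Set.insert_union] using
          h1.insert_cycle (v := fun i => (v i : V)) fun i => hadj (hv i)
      · have h34 := h2.insert_pair (hv 3) (hout _ (by simp)) (hout _ (by
          rw [show (3 : ZMod 5) + 1 = 4 from rfl]; simp))
        have hne : ∀ i j : ZMod 5, i ≠ j → v i ≠ v j := fun i j h => hinj.ne h
        have h12 := h34.insert_pair (hv 1) ?_ ?_
        · refine h12.mono ?_
          simp only [Set.insert_union, Set.singleton_union]
          exact Set.subset_insert _ _
        · rintro (h | h | h)
          exacts [hne 1 3 (by decide) h, hne 1 4 (by decide) h, hout _ (by simp) h]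
        · rintro (h | h | h)
          exacts [hne 2 3 (by decide) h, hne 2 4 (by decide) h, hout (v 2) (by simp) h]

theorem le_matchNum {U : Type} [Finite U] {F : SimpleGraph U} {M : F.Subgraph}
    (hM : M.IsMatching) : M.edgeSet.ncard ≤ matchNum F := by
  refine le_csSup ⟨Nat.card (Sym2 U), ?_⟩ ⟨M, hM, rfl⟩
  rintro _ ⟨M', _, rfl⟩
  exact Set.ncard_le_card _

theorem IsMaximalK2C5Subgraph.fLe [Finite V] {H : G.Subgraph}
    (hH : IsMaximalK2C5Subgraph G H) : FLe G.Adj Set.univ (matchNum H.coe) := by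
  obtain ⟨c, h1, M, hM, -, rfl⟩ := exists_coverBound_hasMatchingIn hH.1 Set.univ
  refine FLe.mono (h1 _ fun u _ v _ huv => ?_) (le_matchNum hM)
  simpa using hH.2 huv

theorem Subgraph.IsMatching.isK2C5Graph_coe {M : G.Subgraph} (hM : M.IsMatching) :
    IsK2C5Graph M.coe := by
  classical
  intro C
  left
  obtain ⟨x, hx⟩ := C.exists_rep
  obtain ⟨y, hxy, -⟩ := hM x.2
  let y' : M.verts := ⟨y, hxy.snd_mem⟩
  have hxy' : M.coe.Adj x y' := hxy
  have hreach : ∀ {u w : M.verts}, M.coe.Walk u w → (u = x ∨ u = y') → (w = x ∨ w = y') := by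
    intro u w p
    induction p with
    | nil => exact id
    | cons h _ ih =>
      rintro (rfl | rfl)
      · exact ih (Or.inr (Subtype.ext (hM.eq_of_adj_left h hxy)))
      · exact ih (Or.inl (Subtype.ext (hM.eq_of_adj_left h hxy.symm)))
  have hsupp : C.supp = {x, y'} := by
    ext w
    rw [ConnectedComponent.mem_supp_iff, ← hx]
    constructor
    · intro h
      obtain ⟨p⟩ := ConnectedComponent.exact h.symm
      exact hreach p (Or.inl rfl)
    · rintro (rfl | rfl)
      · rfl
      · exact ConnectedComponent.sound hxy'.reachable.symm
  have htop : M.coe.induce C.supp = ⊤ := by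
    ext ⟨u, hu⟩ ⟨w, hw⟩
    rw [SimpleGraph.top_adj]
    refine ⟨fun h => h.ne, fun hne => ?_⟩
    change M.coe.Adj u w
    have hne' : u ≠ w := fun h => hne (Subtype.ext h)
    rw [hsupp] at hu hw
    rcases hu with rfl | rfl <;> rcases hw with rfl | rfl
    exacts [absurd rfl hne', hxy', hxy'.symm, absurd rfl hne']
  have hcard : Nat.card C.supp = 2 := by
    rw [hsupp]
    exact Set.ncard_pair hxy'.ne
  have : Finite C.supp := Nat.finite_of_card_ne_zero (by rw [hcard]; decide)
  rw [htop]
  exact ⟨Iso.completeGraph (Finite.equivFinOfCardEq hcard)⟩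

theorem exists_isMaximalK2C5Subgraph [Finite V] (G : SimpleGraph V) :
    ∃ H : G.Subgraph, IsMaximalK2C5Subgraph G H := by
  obtain ⟨M, hM⟩ := (Set.toFinite {M : G.Subgraph | M.IsMatching}).exists_maximal
    ⟨⊥, fun v hv => absurd hv (by simp)⟩
  refine ⟨M, Subgraph.IsMatching.isK2C5Graph_coe hM.1, fun u v huv => ?_⟩
  by_contra! h
  have hmatch : (M ⊔ G.subgraphOfAdj huv).IsMatching := by
    refine Subgraph.IsMatching.sup hM.1 (Subgraph.IsMatching.subgraphOfAdj huv) ?_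
    rw [support_subgraphOfAdj, Set.disjoint_right]
    intro z hz hzM
    have hzT := M.support_subset_verts hzM
    rcases hz with rfl | rfl
    exacts [h.1 hzT, h.2 hzT]
  have hle := hM.2 hmatch le_sup_left
  exact h.1 (hle.1 (Or.inr (by simp)))

theorem fLe_minMatchK2C5 [Finite V] (G : SimpleGraph V) :
    FLe G.Adj Set.univ (minMatchK2C5 G) := by
  obtain ⟨H₀, hH₀⟩ := exists_isMaximalK2C5Subgraph G
  obtain ⟨H, hH, h⟩ := Nat.sInf_mem
    (s := {k | ∃ H : G.Subgraph, IsMaximalK2C5Subgraph G H ∧ matchNum H.coe = k})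
    ⟨_, H₀, hH₀, rfl⟩
  have := hH.fLe
  rwa [h] at this

end Blobs

/-- For every finite simple graph `G` and every `s ≥ 1`,
`reg(I(G)^s) ≤ 2s + min-match_{K₂,C₅}(G) - 1`. -/
theorem stmt8 (K : Type) [Field K] {V : Type} [Fintype V] (G : SimpleGraph V)
    (s : ℕ) (hs : 1 ≤ s) :
    reg K ((edgeIdeal K G) ^ s) ≤ 2 * s + minMatchK2C5 G - 1 := by
  obtain ⟨s, rfl⟩ := Nat.exists_eq_add_of_le' hs
  refine Nat.sInf_le (GrMod.RegLE.hasResolutionDegreeBound ?_)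
  rw [edgeIdeal_pow_eq_powU]
  exact (fLe_minMatchK2C5 G).regU_powU s

end Paper
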